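/- arXiv:1407.7121 — 4 statements merged into one kernel-verified Lean document; each statement's English description precedes it below -/
import Mathlib

section
/- Let n ≥ 3 and let p be a real number with p ≥ (n+2)/(n−2). Then the system −Δu = v^p − u^p, −Δv = u^p in ℝ^n, with u > 0 and v > 0 in ℝ^n, admits a twice continuously differentiable radially symmetric solution, i.e. there exist positive C² functions u, v : ℝ^n → ℝ, each depending on x only through |x|, satisfying the system on all of ℝ^n. -/
noncomputable section
open Set Metric
open scoped BigOperators

/-- The Laplace operator on `ℝ^n`, as the sum of second partial derivatives. -/
def lap {n : ℕ} (u : EuclideanSpace ℝ (Fin n) → ℝ) (x : EuclideanSpace ℝ (Fin n)) : ℝ :=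
  ∑ i, fderiv ℝ (fun y => fderiv ℝ u y (EuclideanSpace.single i 1)) x (EuclideanSpace.single i 1)

/-- A truncation of the power nonlinearity: `C¹`, compactly supported, nonnegative on `[0, ∞)` and
equal to `y ^ p` on `[0, 1]`. -/
lemma exists_truncated_rpow {p : ℝ} (hp : 1 ≤ p) :
    ∃ f : ℝ → ℝ, ContDiff ℝ 1 f ∧ HasCompactSupport f ∧
      (∀ y, 0 ≤ y → 0 ≤ f y) ∧ ∀ y ∈ Icc (0 : ℝ) 1, f y = y ^ p := by
  let b : ContDiffBump (0 : ℝ) := ⟨1, 2, one_pos, one_lt_two⟩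
  refine ⟨fun y => b y * y ^ p, ?_, ?_, ?_, ?_⟩
  · exact b.contDiff.mul (by simpa using Real.contDiff_rpow_const_of_le (n := 1) (by simpa using hp))
  · exact b.hasCompactSupport.mul_right
  · intro y hy
    exact mul_nonneg b.nonneg (Real.rpow_nonneg hy p)
  · intro y hy
    have : b y = 1 := by
      apply b.one_of_mem_closedBall
      simpa [abs_of_nonneg hy.1] using hy.2
    simp [this]

/-- A weighted average of `g` over `[0, s]`, written so that it makes sense for every real `s`.
In the variable `s = |x|²` it inverts the radial Laplacian in dimension `k + 1`. -/
def radialMean (k : ℕ) (g : ℝ → ℝ) (s : ℝ) : ℝ :=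
  ∫ ρ in (0 : ℝ)..1, ρ ^ k * g (s * ρ ^ 2)

lemma continuous_radialMean (k : ℕ) {g : ℝ → ℝ} (hg : Continuous g) :
    Continuous (radialMean k g) := by
  apply intervalIntegral.continuous_parametric_intervalIntegral_of_continuous'
  unfold Function.uncurry
  fun_prop

lemma hasDerivAt_radialMean (k : ℕ) {g g' : ℝ → ℝ} (hg' : Continuous g')
    (hg : ∀ s, HasDerivAt g (g' s) s) (s : ℝ) :
    HasDerivAt (radialMean k g) (radialMean (k + 2) g' s) s := by
  have hgc : Continuous g := continuous_iff_continuousAt.2 fun s => (hg s).continuousAt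
  let F' : ℝ → ℝ → ℝ := fun x ρ => ρ ^ (k + 2) * g' (x * ρ ^ 2)
  obtain ⟨C, hC⟩ := ((isCompact_closedBall s 1).prod (isCompact_Icc (a := (0 : ℝ)) (b := 1)))
    |>.exists_bound_of_continuousOn (f := Function.uncurry F')
      (by unfold Function.uncurry F'; fun_prop)
  refine (intervalIntegral.hasDerivAt_integral_of_dominated_loc_of_deriv_le
    (F := fun x ρ => ρ ^ k * g (x * ρ ^ 2)) (F' := F') (bound := fun _ => C)
    (closedBall_mem_nhds s one_pos) (.of_forall fun x => ?_) ?_ ?_ (.of_forall fun ρ hρ x hx => ?_)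
    (by simp) (.of_forall fun ρ _ x _ => ?_)).2
  · exact Continuous.aestronglyMeasurable (by fun_prop)
  · exact Continuous.intervalIntegrable (by fun_prop) _ _
  · exact Continuous.aestronglyMeasurable (by unfold F'; fun_prop)
  · rw [uIoc_of_le zero_le_one] at hρ
    exact hC (x, ρ) ⟨hx, Ioc_subset_Icc_self hρ⟩
  · have h := ((hg (x * ρ ^ 2)).comp x ((hasDerivAt_id x).mul_const (ρ ^ 2))).const_mul (ρ ^ k)
    convert! h using 1
    simp only [F']
    ring

lemma radialMean_ode (k : ℕ) {g g' : ℝ → ℝ} (hg' : Continuous g')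
    (hg : ∀ s, HasDerivAt g (g' s) s) (s : ℝ) :
    2 * s * radialMean (k + 2) g' s + (k + 1) * radialMean k g s = g s := by
  have hgc : Continuous g := continuous_iff_continuousAt.2 fun s => (hg s).continuousAt
  have key : ∫ ρ in (0 : ℝ)..1, (2 * s * (ρ ^ (k + 2) * g' (s * ρ ^ 2)) +
      (k + 1) * (ρ ^ k * g (s * ρ ^ 2))) = g s := by
    rw [intervalIntegral.integral_eq_sub_of_hasDerivAt (f := fun ρ => ρ ^ (k + 1) * g (s * ρ ^ 2))]
    · simp
    · intro ρ _
      have h := (hasDerivAt_pow (k + 1) ρ).mul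
        ((hg (s * ρ ^ 2)).comp ρ ((hasDerivAt_pow 2 ρ).const_mul s))
      convert! h using 1
      simp only [Function.comp_apply]
      push_cast
      simp
      ring
    · exact Continuous.intervalIntegrable (by fun_prop) _ _
  rw [intervalIntegral.integral_add (Continuous.intervalIntegrable (by fun_prop) _ _)
    (Continuous.intervalIntegrable (by fun_prop) _ _), intervalIntegral.integral_const_mul,
    intervalIntegral.integral_const_mul] at key
  exact key

lemma radialMean_sub (k : ℕ) {g h : ℝ → ℝ} (hg : Continuous g) (hh : Continuous h) (s : ℝ) :
    radialMean k (fun t => g t - h t) s = radialMean k g s - radialMean k h s := by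
  unfold radialMean
  rw [← intervalIntegral.integral_sub (Continuous.intervalIntegrable (by fun_prop) _ _)
    (Continuous.intervalIntegrable (by fun_prop) _ _)]
  simp only [mul_sub]

lemma abs_radialMean_le_cosh (k : ℕ) {g : ℝ → ℝ} {M L : ℝ} (hM : 0 ≤ M)
    (h : ∀ t, |g t| ≤ M * Real.cosh (L * t)) (s : ℝ) :
    |radialMean k g s| ≤ M * Real.cosh (L * s) := by
  have := intervalIntegral.norm_integral_le_of_norm_le_const (a := 0) (b := 1)
    (f := fun ρ : ℝ => ρ ^ k * g (s * ρ ^ 2)) (C := M * Real.cosh (L * s)) ?_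
  · simpa [radialMean] using this
  intro ρ hρ
  rw [uIoc_of_le zero_le_one] at hρ
  have h1 : |ρ ^ k| ≤ 1 := by
    rw [abs_of_nonneg (pow_nonneg hρ.1.le k)]
    exact pow_le_one₀ hρ.1.le hρ.2
  have h2 : Real.cosh (L * (s * ρ ^ 2)) ≤ Real.cosh (L * s) := by
    rw [Real.cosh_le_cosh, ← mul_assoc, abs_mul, abs_of_nonneg (sq_nonneg ρ)]
    exact mul_le_of_le_one_right (abs_nonneg _) (pow_le_one₀ hρ.1.le hρ.2)
  rw [Real.norm_eq_abs, abs_mul]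
  calc |ρ ^ k| * |g (s * ρ ^ 2)| ≤ 1 * (M * Real.cosh (L * (s * ρ ^ 2))) := by
        gcongr
        exact h _
    _ ≤ M * Real.cosh (L * s) := by
        rw [one_mul]
        gcongr

lemma abs_integral_le_cosh {h : ℝ → ℝ} {M L : ℝ} (hM : 0 ≤ M) (hL : 0 < L)
    (hh : ∀ t, |h t| ≤ M * Real.cosh (L * t)) (s : ℝ) :
    |∫ t in (0 : ℝ)..s, h t| ≤ M / L * Real.cosh (L * s) := by
  have h1 : |∫ t in (0 : ℝ)..s, h t| ≤ |∫ t in (0 : ℝ)..s, M * Real.cosh (L * t)| :=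
    intervalIntegral.norm_integral_le_abs_of_norm_le (f := h)
      (g := fun t => M * Real.cosh (L * t)) (.of_forall hh)
      ((by fun_prop : Continuous fun t => M * Real.cosh (L * t)).intervalIntegrable _ _)
  have h2 : ∫ t in (0 : ℝ)..s, M * Real.cosh (L * t) = M / L * Real.sinh (L * s) := by
    rw [intervalIntegral.integral_eq_sub_of_hasDerivAt (f := fun t => M / L * Real.sinh (L * t))]
    · simp
    · intro t _
      have := (((hasDerivAt_id t).const_mul L).sinh).const_mul (M / L)
      convert! this using 1
      simp
      field_simp
    · exact (by fun_prop : Continuous fun t => M * Real.cosh (L * t)).intervalIntegrable _ _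
  rw [h2, abs_mul, abs_of_nonneg (div_nonneg hM hL.le), Real.abs_sinh] at h1
  refine h1.trans ?_
  rw [← Real.cosh_abs (L * s)]
  gcongr
  exact (Real.sinh_lt_cosh _).le

/-- Global solvability of the integral form of the radial equation, by the contraction principle
in a `cosh`-weighted space. -/
lemma exists_radial_integral_solution (k : ℕ) {f : ℝ → ℝ} {K : NNReal} (hK : LipschitzWith K f)
    {C : ℝ} (hC : ∀ y, |f y| ≤ C) :
    ∃ φ : ℝ → ℝ, Continuous φ ∧
      ∀ s, φ s = 1 - 1 / 2 * ∫ t in (0 : ℝ)..s, radialMean k (f ∘ φ) t := by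
  have hfc : Continuous f := hK.continuous
  have hC0 : 0 ≤ C := (abs_nonneg _).trans (hC 0)
  obtain ⟨L, hL⟩ : ∃ L : ℝ, L = K + 1 := ⟨_, rfl⟩
  have hLpos : 0 < L := by rw [hL]; positivity
  let w : ℝ → ℝ := fun s => Real.cosh (L * s)
  have hwc : Continuous w := by fun_prop
  have hw0 : ∀ s, 0 < w s := fun s => Real.cosh_pos _
  let S : (ℝ → ℝ) → ℝ → ℝ := fun ψ s =>
    1 - 1 / 2 * ∫ t in (0 : ℝ)..s, radialMean k (fun r => f (w r * ψ r)) t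
  have hSc : ∀ ψ : ℝ → ℝ, Continuous ψ → Continuous (S ψ) := fun ψ hψ => by
    have := intervalIntegral.continuous_primitive
      (fun a b => (continuous_radialMean k (g := fun r => f (w r * ψ r))
        (by fun_prop)).intervalIntegrable (μ := MeasureTheory.volume) a b) 0
    exact continuous_const.sub (continuous_const.mul this)
  have hSb : ∀ ψ : ℝ → ℝ, ∀ s, |S ψ s| ≤ (1 + 1 / 2 * (C / L)) * w s := fun ψ s => by
    have h1 := abs_integral_le_cosh hC0 hLpos
      (abs_radialMean_le_cosh k hC0 (g := fun r => f (w r * ψ r)) (L := L) fun t =>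
        (hC _).trans (le_mul_of_one_le_right hC0 (Real.one_le_cosh _))) s
    have h2 : 1 ≤ w s := Real.one_le_cosh _
    have h3 := abs_le.1 h1
    simp only [S, abs_le]
    constructor <;> nlinarith [h3.1, h3.2]
  let T : BoundedContinuousFunction ℝ ℝ → BoundedContinuousFunction ℝ ℝ := fun ψ =>
    .ofNormedAddCommGroup (fun s => S ψ s / w s)
      ((hSc ψ ψ.continuous).div hwc fun s => (hw0 s).ne') (1 + 1 / 2 * (C / L)) fun s => by
        rw [Real.norm_eq_abs, abs_div, abs_of_pos (hw0 s), div_le_iff₀ (hw0 s)]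
        exact hSb ψ s
  have hT : ContractingWith (1 / 2 : NNReal) T := by
    refine ⟨by norm_num [← NNReal.coe_lt_coe], LipschitzWith.of_dist_le_mul fun ψ χ => ?_⟩
    rw [BoundedContinuousFunction.dist_le (by positivity)]
    intro s
    have hd : 0 ≤ dist ψ χ := dist_nonneg
    have hpt : ∀ t, |f (w t * ψ t) - f (w t * χ t)| ≤ K * dist ψ χ * Real.cosh (L * t) := by
      intro t
      have h1 := hK.dist_le_mul (w t * ψ t) (w t * χ t)
      rw [Real.dist_eq, Real.dist_eq, ← mul_sub, abs_mul, abs_of_pos (hw0 t), ← Real.dist_eq (ψ t)]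
        at h1
      calc _ ≤ _ := h1
        _ ≤ K * (w t * dist ψ χ) := by
          gcongr
          exact BoundedContinuousFunction.dist_coe_le_dist t
        _ = _ := by simp only [w]; ring
    have hcψ : Continuous fun t => f (w t * ψ t) := by fun_prop
    have hcχ : Continuous fun t => f (w t * χ t) := by fun_prop
    have hint := abs_integral_le_cosh (by positivity) hLpos
      (abs_radialMean_le_cosh k (by positivity) hpt) s
    simp only [radialMean_sub k hcψ hcχ] at hint
    rw [intervalIntegral.integral_sub ((continuous_radialMean k hcψ).intervalIntegrable _ _)
      ((continuous_radialMean k hcχ).intervalIntegrable _ _)] at hint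
    have hKL : K * dist ψ χ / L ≤ dist ψ χ := by
      rw [div_le_iff₀ hLpos, hL]
      nlinarith
    change dist (S ψ s / w s) (S χ s / w s) ≤ _
    rw [Real.dist_eq, ← sub_div, abs_div, abs_of_pos (hw0 s), div_le_iff₀ (hw0 s)]
    have h3 := abs_le.1 (hint.trans (mul_le_mul_of_nonneg_right hKL (hw0 s).le))
    simp only [S, abs_le]
    push_cast
    constructor <;> linarith [h3.1, h3.2]
  obtain ⟨ψ, hψ⟩ : ∃ ψ, T ψ = ψ := ⟨_, hT.fixedPoint_isFixedPt⟩
  refine ⟨fun s => w s * ψ s, by fun_prop, fun s => ?_⟩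
  have h : S ψ s / w s = ψ s := congrArg (fun χ : BoundedContinuousFunction ℝ ℝ => χ s) hψ
  rw [div_eq_iff (hw0 s).ne'] at h
  exact (mul_comm _ _).trans h.symm

/-- The radial equation `4 s φ'' + 2 (k + 1) φ' = -f(φ)`, `φ(0) = 1`, has a global `C²` solution. -/
lemma exists_radial_solution (k : ℕ) {f : ℝ → ℝ} (hf : ContDiff ℝ 1 f)
    (hfs : HasCompactSupport f) :
    ∃ φ φ' φ'' : ℝ → ℝ, φ 0 = 1 ∧ Continuous φ'' ∧ (∀ s, HasDerivAt φ (φ' s) s) ∧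
      (∀ s, HasDerivAt φ' (φ'' s) s) ∧ (∀ s, φ' s = -(1 / 2) * radialMean k (f ∘ φ) s) ∧
      ∀ s, 4 * s * φ'' s + 2 * (k + 1) * φ' s = -f (φ s) := by
  obtain ⟨K, hK⟩ := hf.lipschitzWith_of_hasCompactSupport hfs one_ne_zero
  obtain ⟨C, hC⟩ := hfs.exists_bound_of_continuous hf.continuous
  obtain ⟨φ, hφc, hφ⟩ := exists_radial_integral_solution k hK hC
  have hmc := continuous_radialMean k (hf.continuous.comp hφc)
  have hφ1 : ∀ s, HasDerivAt φ (-(1 / 2) * radialMean k (f ∘ φ) s) s := fun s => by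
    have h := ((intervalIntegral.integral_hasDerivAt_right (hmc.intervalIntegrable 0 s)
      (hmc.stronglyMeasurableAtFilter _ _) hmc.continuousAt).const_mul (1 / 2)).const_sub 1
    rw [← funext hφ] at h
    convert! h using 1
    ring
  let g' : ℝ → ℝ := fun s => deriv f (φ s) * (-(1 / 2) * radialMean k (f ∘ φ) s)
  have hg'c : Continuous g' :=
    ((hf.continuous_deriv le_rfl).comp hφc).mul (continuous_const.mul hmc)
  have hg : ∀ s, HasDerivAt (f ∘ φ) (g' s) s := fun s =>
    ((hf.differentiable one_ne_zero (φ s)).hasDerivAt).comp s (hφ1 s)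
  refine ⟨φ, fun s => -(1 / 2) * radialMean k (f ∘ φ) s,
    fun s => -(1 / 2) * radialMean (k + 2) g' s, ?_,
    continuous_const.mul (continuous_radialMean _ hg'c), hφ1,
    fun s => (hasDerivAt_radialMean k hg'c hg s).const_mul _, fun s => rfl, fun s => ?_⟩
  · simp [hφ 0]
  · have := radialMean_ode k hg'c hg s
    simp only [Function.comp_apply] at this
    linear_combination -this

/-- A radial solution whose nonlinearity agrees with a critical or supercritical power on `[0, 1]`
never vanishes: a first zero would contradict the Pohozaev identity. -/
lemma radial_solution_mem_Ioc {k : ℕ} {p : ℝ} (hp : 1 ≤ p)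
    (hpk : 2 * ((k : ℝ) + 1) ≤ (k - 1) * (p + 1)) {f φ φ' φ'' : ℝ → ℝ} (hf : Continuous f)
    (hf0 : ∀ y, 0 ≤ y → 0 ≤ f y) (hfp : ∀ y ∈ Icc (0 : ℝ) 1, f y = y ^ p) (hφ0 : φ 0 = 1)
    (hφ1 : ∀ s, HasDerivAt φ (φ' s) s) (hφ2 : ∀ s, HasDerivAt φ' (φ'' s) s)
    (hφ' : ∀ s, φ' s = -(1 / 2) * radialMean k (f ∘ φ) s)
    (hode : ∀ s, 4 * s * φ'' s + 2 * (k + 1) * φ' s = -f (φ s)) {s : ℝ} (hs : 0 ≤ s) :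
    φ s ∈ Ioc (0 : ℝ) 1 := by
  have hφc : Continuous φ := continuous_iff_continuousAt.2 fun s => (hφ1 s).continuousAt
  have hφ'c : Continuous φ' := continuous_iff_continuousAt.2 fun s => (hφ2 s).continuousAt
  have hscale : ∀ {t ρ : ℝ}, 0 ≤ t → ρ ∈ Icc (0 : ℝ) 1 → t * ρ ^ 2 ∈ Icc 0 t := fun ht hρ =>
    ⟨mul_nonneg ht (sq_nonneg _), mul_le_of_le_one_right ht (pow_le_one₀ hρ.1 hρ.2)⟩
  have hle : ∀ S, 0 ≤ S → (∀ t ∈ Icc 0 S, 0 ≤ φ t) → φ S ≤ 1 := by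
    intro S hS hnn
    have hanti : AntitoneOn φ (Icc 0 S) := by
      refine antitoneOn_of_deriv_nonpos (convex_Icc 0 S) hφc.continuousOn
        (fun t _ => (hφ1 t).differentiableAt.differentiableWithinAt) fun t ht => ?_
      rw [interior_Icc] at ht
      rw [(hφ1 t).deriv, hφ' t]
      have : 0 ≤ radialMean k (f ∘ φ) t :=
        intervalIntegral.integral_nonneg zero_le_one fun ρ hρ =>
          mul_nonneg (pow_nonneg hρ.1 k) (hf0 _ (hnn _
            (Icc_subset_Icc_right ht.2.le (hscale ht.1.le hρ))))
      linarith
    rw [← hφ0]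
    exact hanti (left_mem_Icc.2 hS) (right_mem_Icc.2 hS) hS
  have hzero : ∀ t, 0 ≤ t → φ t ≤ 0 → ∃ z ∈ Icc 0 t, φ z = 0 := fun t ht h =>
    intermediate_value_Icc' ht hφc.continuousOn ⟨h, by rw [hφ0]; exact zero_le_one⟩
  suffices hpos : ∀ t, 0 ≤ t → 0 < φ t from
    ⟨hpos s hs, hle s hs fun t ht => (hpos t ht.1).le⟩
  by_contra! hneg
  obtain ⟨t, ht, hφt⟩ := hneg
  obtain ⟨z, ⟨hz0, -⟩, hφz⟩ := hzero t ht hφt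
  obtain ⟨S, ⟨hS0, hφS⟩, hSmin⟩ : ∃ S, IsLeast {z | 0 ≤ z ∧ φ z = 0} S :=
    ⟨_, IsClosed.isLeast_csInf
      ((isClosed_le continuous_const continuous_id).inter (isClosed_eq hφc continuous_const))
      ⟨z, hz0, hφz⟩ ⟨0, fun _ h => h.1⟩⟩
  have hSpos : 0 < S := hS0.lt_of_ne fun h => by simp [← h, hφ0] at hφS
  have hpos : ∀ t, 0 ≤ t → t < S → 0 < φ t := by
    intro t ht htS
    by_contra! h
    obtain ⟨z, hz, hφz⟩ := hzero t ht h
    exact absurd (hSmin ⟨hz.1, hφz⟩) (by linarith [hz.2])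
  have hle1 : ∀ t, 0 ≤ t → t < S → φ t ≤ 1 := fun t ht htS =>
    hle t ht fun r hr => (hpos r hr.1 (hr.2.trans_lt htS)).le
  have hf1 : ∀ t, 0 ≤ t → t < S → f (φ t) = φ t ^ p := fun t ht htS =>
    hfp _ ⟨(hpos t ht htS).le, hle1 t ht htS⟩
  have hφ'S : φ' S < 0 := by
    have : 0 < radialMean k (f ∘ φ) S := by
      refine intervalIntegral.intervalIntegral_pos_of_pos_on
        (Continuous.intervalIntegrable (by fun_prop) _ _) (fun ρ hρ => ?_) one_pos
      have h0 : 0 ≤ S * ρ ^ 2 := by positivity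
      have h1 : S * ρ ^ 2 < S :=
        mul_lt_of_lt_one_right hSpos (pow_lt_one₀ hρ.1.le hρ.2 two_ne_zero)
      rw [Function.comp_apply, hf1 _ h0 h1]
      exact mul_pos (pow_pos hρ.1 k) (Real.rpow_pos_of_pos (hpos _ h0 h1) p)
    rw [hφ']
    linarith
  let P : ℝ → ℝ := fun r => r ^ (k + 1) *
    (2 * r ^ 2 * φ' (r ^ 2) ^ 2 + φ (r ^ 2) ^ (p + 1) / (p + 1) + (k - 1) * (φ (r ^ 2) * φ' (r ^ 2)))
  have hPd : ∀ r ∈ Ioo 0 √S, HasDerivAt P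
      (2 * r ^ k * φ (r ^ 2) ^ (p + 1) * ((k + 1) / (2 * (p + 1)) - (k - 1) / 4)) r := by
    intro r hr
    have hrS : r ^ 2 < S := (Real.lt_sqrt hr.1.le).1 hr.2
    have hode_r := hode (r ^ 2)
    rw [hf1 _ (sq_nonneg r) hrS] at hode_r
    have hsq := hasDerivAt_pow 2 r
    have d0 := (hφ1 (r ^ 2)).comp r hsq
    have d1 := (hφ2 (r ^ 2)).comp r hsq
    have dp := (d0.rpow_const (p := p + 1) (Or.inr (by linarith))).div_const (p + 1)
    have h := (hasDerivAt_pow (k + 1) r).mul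
      ((((hsq.const_mul 2).mul (d1.pow 2)).add dp).add ((d0.mul d1).const_mul ((k : ℝ) - 1)))
    convert! h using 1
    simp only [Function.comp_apply, Pi.mul_apply, Pi.add_apply, Pi.pow_apply]
    have hpow : φ (r ^ 2) ^ (p + 1) = φ (r ^ 2) ^ p * φ (r ^ 2) := by
      rw [Real.rpow_add_one (hpos _ (sq_nonneg r) hrS).ne']
    rw [hpow, add_sub_cancel_right]
    have hp1 : p + 1 ≠ 0 := by linarith
    generalize φ (r ^ 2) ^ p = X at *
    push_cast
    obtain rfl : X = -(4 * r ^ 2 * φ'' (r ^ 2) + 2 * (k + 1) * φ' (r ^ 2)) := by linarith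
    field_simp
    ring
  have hPanti : AntitoneOn P (Icc 0 √S) := by
    refine antitoneOn_of_deriv_nonpos (convex_Icc _ _) ?_ ?_ ?_
    · have : Continuous fun r : ℝ => φ (r ^ 2) ^ (p + 1) :=
        (hφc.comp (continuous_pow 2)).rpow_const fun _ => Or.inr (by linarith)
      exact Continuous.continuousOn (by fun_prop)
    · rw [interior_Icc]
      exact fun r hr => (hPd r hr).differentiableAt.differentiableWithinAt
    · rw [interior_Icc]
      intro r hr
      rw [(hPd r hr).deriv]
      have hφr := hpos (r ^ 2) (sq_nonneg r) ((Real.lt_sqrt hr.1.le).1 hr.2)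
      refine mul_nonpos_of_nonneg_of_nonpos
        (mul_nonneg (mul_nonneg zero_le_two (pow_nonneg hr.1.le k)) (Real.rpow_nonneg hφr.le _)) ?_
      rw [sub_nonpos, div_le_div_iff₀ (by linarith) (by norm_num)]
      linarith
  have hP := hPanti (left_mem_Icc.2 (Real.sqrt_nonneg S)) (right_mem_Icc.2 (Real.sqrt_nonneg S))
    (Real.sqrt_nonneg S)
  have hp1 : p + 1 ≠ 0 := by linarith
  simp only [P, Real.sq_sqrt hS0, hφS, Real.zero_rpow hp1] at hP
  have h1 : 0 < √S ^ (k + 1) * (2 * S * φ' S ^ 2) :=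
    mul_pos (pow_pos (Real.sqrt_pos.2 hSpos) _) (mul_pos (by linarith) (sq_pos_of_neg hφ'S))
  simp at hP
  linarith

lemma lap_comp_norm_sq {n : ℕ} {φ φ' φ'' : ℝ → ℝ} (h1 : ∀ s, HasDerivAt φ (φ' s) s)
    (h2 : ∀ s, HasDerivAt φ' (φ'' s) s) (x : EuclideanSpace ℝ (Fin n)) :
    lap (fun y => φ (‖y‖ ^ 2)) x = 4 * ‖x‖ ^ 2 * φ'' (‖x‖ ^ 2) + 2 * n * φ' (‖x‖ ^ 2) := by
  have hN : ∀ y : EuclideanSpace ℝ (Fin n), HasFDerivAt (fun y => ‖y‖ ^ 2) (2 • innerSL ℝ y) y :=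
    fun y => (hasStrictFDerivAt_norm_sq y).hasFDerivAt
  have hfst : ∀ (y : EuclideanSpace ℝ (Fin n)) (i : Fin n),
      fderiv ℝ (fun y => φ (‖y‖ ^ 2)) y (EuclideanSpace.single i 1) =
        φ' (‖y‖ ^ 2) * (2 * y i) := fun y i => by
    have h : HasFDerivAt (fun y => φ (‖y‖ ^ 2)) _ y := (h1 (‖y‖ ^ 2)).comp_hasFDerivAt y (hN y)
    rw [h.fderiv]
    simp [EuclideanSpace.inner_single_right]
  have hsnd : ∀ i : Fin n, fderiv ℝ (fun y : EuclideanSpace ℝ (Fin n) => φ' (‖y‖ ^ 2) * (2 * y i)) x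
      (EuclideanSpace.single i 1) = 4 * φ'' (‖x‖ ^ 2) * x i ^ 2 + 2 * φ' (‖x‖ ^ 2) := fun i => by
    have hc : HasFDerivAt (fun y : EuclideanSpace ℝ (Fin n) => y i)
        (EuclideanSpace.proj i : EuclideanSpace ℝ (Fin n) →L[ℝ] ℝ) x :=
      (EuclideanSpace.proj i : EuclideanSpace ℝ (Fin n) →L[ℝ] ℝ).hasFDerivAt
    have h : HasFDerivAt (fun y : EuclideanSpace ℝ (Fin n) => φ' (‖y‖ ^ 2) * (2 * y i)) _ x :=
      ((h2 (‖x‖ ^ 2)).comp_hasFDerivAt x (hN x)).mul (hc.const_mul 2)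
    rw [h.fderiv]
    simp [EuclideanSpace.inner_single_right]
    ring
  simp only [lap, hfst, hsnd, Finset.sum_add_distrib, ← Finset.mul_sum,
    ← EuclideanSpace.real_norm_sq_eq]
  simp
  ring

/-- The Lane–Emden equation `-Δw = w ^ p` with critical or supercritical `p` has an entire positive
radial solution. -/
lemma exists_laneEmden_solution {n : ℕ} (hn : 3 ≤ n) {p : ℝ}
    (hp : ((n : ℝ) + 2) / (n - 2) ≤ p) :
    ∃ φ φ' φ'' : ℝ → ℝ, Continuous φ'' ∧ (∀ s, HasDerivAt φ (φ' s) s) ∧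
      (∀ s, HasDerivAt φ' (φ'' s) s) ∧ (∀ s, 0 ≤ s → 0 < φ s) ∧
      ∀ s, 0 ≤ s → 4 * s * φ'' s + 2 * n * φ' s = -φ s ^ p := by
  obtain ⟨k, rfl⟩ : ∃ k, n = k + 1 := ⟨n - 1, by omega⟩
  have hk : 2 ≤ k := by omega
  have hk' : (2 : ℝ) ≤ k := by exact_mod_cast hk
  push_cast at hp ⊢
  rw [div_le_iff₀ (by linarith)] at hp
  have hp1 : 1 ≤ p := by nlinarith
  obtain ⟨f, hf, hfs, hf0, hfp⟩ := exists_truncated_rpow hp1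
  obtain ⟨φ, φ', φ'', hφ0, hφ''c, hφ1, hφ2, hφ', hode⟩ := exists_radial_solution k hf hfs
  have hmem : ∀ s, 0 ≤ s → φ s ∈ Ioc (0 : ℝ) 1 := fun s hs =>
    radial_solution_mem_Ioc hp1 (by linarith) hf.continuous hf0 hfp hφ0 hφ1 hφ2 hφ' hode hs
  exact ⟨φ, φ', φ'', hφ''c, hφ1, hφ2, fun s hs => (hmem s hs).1, fun s hs => by
    rw [hode, hfp _ (Ioc_subset_Icc_self (hmem s hs))]⟩

lemma exists_proportionality_constants {p : ℝ} (hp : 1 < p) :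
    ∃ a c : ℝ, 0 < a ∧ 0 < c ∧ a = (c * a) ^ p - a ^ p ∧ c * a = a ^ p := by
  obtain ⟨c, ⟨hc1, -⟩, hc⟩ : ∃ c ∈ Icc (1 : ℝ) 2, c * (c ^ p - 1) = 1 := by
    refine intermediate_value_Icc (f := fun c : ℝ => c * (c ^ p - 1)) one_le_two ?_ ⟨by simp, ?_⟩
    · have : Continuous fun c : ℝ => c ^ p := Real.continuous_rpow_const (by linarith)
      exact Continuous.continuousOn (by fun_prop)
    · have := Real.rpow_le_rpow_of_exponent_le one_le_two hp.le
      rw [Real.rpow_one] at this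
      linarith
  have hc0 : 0 < c := by linarith
  have ha0 : 0 < c ^ (p - 1)⁻¹ := Real.rpow_pos_of_pos hc0 _
  have hap : c * c ^ (p - 1)⁻¹ = (c ^ (p - 1)⁻¹) ^ p := by
    rw [← Real.rpow_mul hc0.le, ← Real.rpow_one_add' hc0.le]
    · congr 1
      have : p - 1 ≠ 0 := by linarith
      field_simp
      ring
    · have : 0 < (p - 1)⁻¹ := inv_pos.2 (by linarith)
      positivity
  refine ⟨c ^ (p - 1)⁻¹, c, ha0, hc0, ?_, hap⟩
  rw [Real.mul_rpow hc0.le ha0.le, ← hap]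
  linear_combination -c ^ (p - 1)⁻¹ * hc

/-- **Existence for the sign-changing system** `-Δu = v^p - u^p`, `-Δv = u^p` in `ℝ^n`:
for `p ≥ (n+2)/(n-2)` the system admits a positive radially symmetric C² solution. -/
theorem signChanging_existence (n : ℕ) (hn : 3 ≤ n) (p : ℝ)
    (hp : ((n:ℝ) + 2) / ((n:ℝ) - 2) ≤ p) :
    ∃ u v : EuclideanSpace ℝ (Fin n) → ℝ,
      ContDiff ℝ 2 u ∧ ContDiff ℝ 2 v ∧
      (∀ x, 0 < u x) ∧ (∀ x, 0 < v x) ∧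
      (∀ x y : EuclideanSpace ℝ (Fin n), ‖x‖ = ‖y‖ → u x = u y) ∧
      (∀ x y : EuclideanSpace ℝ (Fin n), ‖x‖ = ‖y‖ → v x = v y) ∧
      (∀ x, - lap u x = v x ^ p - u x ^ p) ∧
      (∀ x, - lap v x = u x ^ p) := by
  have hn' : (3 : ℝ) ≤ n := by exact_mod_cast hn
  have hp1 : 1 < p := lt_of_lt_of_le (by rw [lt_div_iff₀] <;> linarith) hp
  obtain ⟨φ, φ', φ'', hφ''c, hφ1, hφ2, hpos, hode⟩ := exists_laneEmden_solution hn hp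
  obtain ⟨a, c, ha, hc, hu, hv⟩ := exists_proportionality_constants hp1
  have hφ : ContDiff ℝ 2 φ := by
    rw [show (2 : WithTop ℕ∞) = 1 + 1 by norm_num, contDiff_succ_iff_deriv,
      funext fun s => (hφ1 s).deriv, contDiff_one_iff_deriv, funext fun s => (hφ2 s).deriv]
    exact ⟨fun s => (hφ1 s).differentiableAt, by simp, fun s => (hφ2 s).differentiableAt, hφ''c⟩
  have hw : ContDiff ℝ 2 fun x : EuclideanSpace ℝ (Fin n) => φ (‖x‖ ^ 2) :=
    hφ.comp (contDiff_norm_sq ℝ)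
  have hlap : ∀ (b : ℝ) (x : EuclideanSpace ℝ (Fin n)),
      -lap (fun y => b * φ (‖y‖ ^ 2)) x = b * φ (‖x‖ ^ 2) ^ p := fun b x => by
    rw [lap_comp_norm_sq (φ := fun s => b * φ s) (fun s => (hφ1 s).const_mul b)
      (fun s => (hφ2 s).const_mul b)]
    linear_combination -b * hode (‖x‖ ^ 2) (sq_nonneg _)
  have hpow : ∀ (b : ℝ) (x : EuclideanSpace ℝ (Fin n)), 0 < b →
      (b * φ (‖x‖ ^ 2)) ^ p = b ^ p * φ (‖x‖ ^ 2) ^ p := fun b x hb =>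
    Real.mul_rpow hb.le (hpos _ (sq_nonneg _)).le
  refine ⟨fun x => a * φ (‖x‖ ^ 2), fun x => c * a * φ (‖x‖ ^ 2), contDiff_const.mul hw,
    contDiff_const.mul hw, fun x => mul_pos ha (hpos _ (sq_nonneg _)),
    fun x => mul_pos (mul_pos hc ha) (hpos _ (sq_nonneg _)), fun x y h => by simp only [h],
    fun x y h => by simp only [h], fun x => ?_, fun x => ?_⟩
  · simp only
    rw [hlap, hpow _ _ ha, hpow _ _ (mul_pos hc ha), ← sub_mul, ← hu]
  · simp only
    rw [hlap, hpow _ _ ha, ← hv]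
end
end

section
/- Let n ≥ 3, let p > 1 be a real number, and let R > 0. Suppose u, v are twice continuously differentiable on a neighborhood of the closed ball B̄_R ⊂ ℝ^n with −Δu = v^p − u^p and −Δv = u^p in B_R, u > 0 and v > 0 in B_R, and u = v = 0 on ∂B_R. Then ∫_{B_R} [Δu(x) (x·∇v(x)) + Δv(x) (x·∇u(x)) − (n−2) ∇u(x)·∇v(x)] dx > 0. -/
noncomputable section
open Set Metric
open scoped BigOperators RealInnerProductSpace

open MeasureTheory Filter Topology

/-- The divergence of a vector field on `ℝ^n`. -/
def dvg {n : ℕ} (G : EuclideanSpace ℝ (Fin n) → EuclideanSpace ℝ (Fin n))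
    (x : EuclideanSpace ℝ (Fin n)) : ℝ :=
  ∑ i, fderiv ℝ G x (EuclideanSpace.single i 1) i

section Divergence

variable {n : ℕ} {G : EuclideanSpace ℝ (Fin n) → EuclideanSpace ℝ (Fin n)}

lemma HasFDerivAt.dvg_eq {x : EuclideanSpace ℝ (Fin n)}
    {G' : EuclideanSpace ℝ (Fin n) →L[ℝ] EuclideanSpace ℝ (Fin n)} (h : HasFDerivAt G G' x) :
    dvg G x = ∑ i, G' (EuclideanSpace.single i 1) i := by
  simp [dvg, h.fderiv]

lemma continuousOn_dvg {U : Set (EuclideanSpace ℝ (Fin n))} (hU : IsOpen U)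
    (hG : ContDiffOn ℝ 1 G U) : ContinuousOn (dvg G) U := by
  have := hG.continuousOn_fderiv_of_isOpen hU le_rfl
  unfold dvg
  fun_prop

lemma integral_dvg_eq_zero (hG : ContDiff ℝ 1 G) (hc : HasCompactSupport G) :
    ∫ x, dvg G x = 0 := by
  have hcont : ∀ i, Continuous fun x => fderiv ℝ G x (EuclideanSpace.single i 1) i := by
    have := hG.continuous_fderiv one_ne_zero
    intro i
    fun_prop
  have hint : ∀ i, Integrable fun x => fderiv ℝ G x (EuclideanSpace.single i 1) i := fun i =>
    (hcont i).integrable_of_hasCompactSupport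
      ((hc.fderiv ℝ).comp_left
        (g := fun L : EuclideanSpace ℝ (Fin n) →L[ℝ] EuclideanSpace ℝ (Fin n) =>
          L (EuclideanSpace.single i 1) i) (by simp))
  unfold dvg
  rw [integral_finsetSum _ fun i _ => hint i]
  refine Finset.sum_eq_zero fun i _ => ?_
  have hd : ∀ x, HasFDerivAt (fun y => G y i)
      ((EuclideanSpace.proj i : EuclideanSpace ℝ (Fin n) →L[ℝ] ℝ).comp (fderiv ℝ G x)) x :=
    fun x => (EuclideanSpace.proj i : EuclideanSpace ℝ (Fin n) →L[ℝ] ℝ).hasFDerivAt.comp x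
      (hG.differentiable one_ne_zero x).hasFDerivAt
  have hf : ∀ x, fderiv ℝ (fun y => G y i) x (EuclideanSpace.single i 1)
      = fderiv ℝ G x (EuclideanSpace.single i 1) i := fun x => by
    rw [(hd x).fderiv]; rfl
  have hci : HasCompactSupport fun y => G y i :=
    hc.comp_left (g := fun y : EuclideanSpace ℝ (Fin n) => y i) (by simp)
  have hGi : Integrable fun y => G y i :=
    Continuous.integrable_of_hasCompactSupport (by have := hG.continuous; fun_prop) hci
  have := integral_mul_fderiv_eq_neg_fderiv_mul_of_integrable (μ := volume)
    (f := fun _ : EuclideanSpace ℝ (Fin n) => (1 : ℝ)) (g := fun y => G y i)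
    (v := EuclideanSpace.single i 1) (by simp) (by simpa [hf] using hint i) (by simpa using hGi)
    (fun x _ => differentiableAt_const _) (fun x _ => (hd x).differentiableAt)
  simpa [hf] using this

end Divergence

section Ball

variable {n : ℕ} {R : ℝ}

lemma exists_shell_nonneg (hR : 0 < R) {f : EuclideanSpace ℝ (Fin n) → ℝ}
    (hf : ContinuousOn f (closedBall 0 R)) (hpos : ∀ x ∈ sphere 0 R, 0 < f x) :
    ∃ r, 0 ≤ r ∧ r < R ∧ ∀ x ∈ closedBall 0 R, r < ‖x‖ → 0 ≤ f x := by
  let K := closedBall (0 : EuclideanSpace ℝ (Fin n)) R ∩ f ⁻¹' Iic 0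
  have hK : IsCompact K := (isCompact_closedBall 0 R).of_isClosed_subset
    (hf.preimage_isClosed_of_isClosed isClosed_closedBall isClosed_Iic) inter_subset_left
  rcases K.eq_empty_or_nonempty with hE | hne
  · refine ⟨0, le_rfl, hR, fun x hx _ => ?_⟩
    by_contra! h
    exact (Set.ext_iff.1 hE x).1 ⟨hx, h.le⟩
  · obtain ⟨z, ⟨hzR, hz⟩, hmax⟩ := hK.exists_isMaxOn hne continuous_norm.continuousOn
    refine ⟨‖z‖, norm_nonneg z, lt_of_le_of_ne (by simpa using hzR) fun h => ?_, fun x hx hlt => ?_⟩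
    · exact (hpos z (by simpa using h)).not_ge hz
    · by_contra! h
      exact hlt.not_ge (hmax ⟨hx, h.le⟩)

lemma ball_ae_eq_closedBall (hR : 0 < R) :
    (ball (0 : EuclideanSpace ℝ (Fin n)) R : Set _) =ᵐ[volume] closedBall 0 R := by
  rw [← ball_union_sphere]
  exact (union_ae_eq_left_of_ae_eq_empty
    (ae_eq_empty.2 (Measure.addHaar_sphere_of_ne_zero volume 0 hR.ne'))).symm

/-- A smooth cutoff that vanishes outside the ball of radius `R`. -/
def ballCutoff (R : ℝ) (k : ℕ) (x : EuclideanSpace ℝ (Fin n)) : ℝ :=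
  Real.smoothTransition (k * (R ^ 2 - ‖x‖ ^ 2))

lemma contDiff_ballCutoff (k : ℕ) :
    ContDiff ℝ 1 (ballCutoff R k : EuclideanSpace ℝ (Fin n) → ℝ) :=
  (Real.smoothTransition.contDiff (n := 1)).comp
    (contDiff_const.mul (contDiff_const.sub (contDiff_norm_sq ℝ)))

lemma fderiv_ballCutoff (k : ℕ) (x w : EuclideanSpace ℝ (Fin n)) :
    fderiv ℝ (ballCutoff R k) x w
      = deriv Real.smoothTransition (k * (R ^ 2 - ‖x‖ ^ 2)) * (k * -(2 * ⟪x, w⟫)) := by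
  have h1 : HasFDerivAt (fun y : EuclideanSpace ℝ (Fin n) => k * (R ^ 2 - ‖y‖ ^ 2)) _ x :=
    ((hasStrictFDerivAt_norm_sq x).hasFDerivAt.const_sub (R ^ 2)).const_mul (k : ℝ)
  have h2 : HasDerivAt Real.smoothTransition _ (k * (R ^ 2 - ‖x‖ ^ 2)) :=
    ((Real.smoothTransition.contDiff (n := 1)).differentiable one_ne_zero _).hasDerivAt
  have h3 : HasFDerivAt (ballCutoff R k) _ x := h2.comp_hasFDerivAt x h1
  rw [h3.fderiv]
  simp

lemma ballCutoff_eq_zero (hR : 0 < R) {k : ℕ} {x : EuclideanSpace ℝ (Fin n)} (hx : x ∉ ball 0 R) :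
    ballCutoff R k x = 0 := by
  refine Real.smoothTransition.zero_of_nonpos (mul_nonpos_of_nonneg_of_nonpos k.cast_nonneg ?_)
  have : R ≤ ‖x‖ := by simpa using hx
  nlinarith

lemma deriv_smoothTransition_of_one_lt {t : ℝ} (ht : 1 < t) : deriv Real.smoothTransition t = 0 := by
  have : Real.smoothTransition =ᶠ[𝓝 t] fun _ => 1 :=
    (eventually_gt_nhds ht).mono fun s hs => Real.smoothTransition.one_of_one_le hs.le
  rw [this.deriv_eq]
  simp

/-- A vector field that points outwards along the sphere has nonnegative total divergence. -/
lemma integral_dvg_nonneg {U : Set (EuclideanSpace ℝ (Fin n))} (hR : 0 < R) (hU : IsOpen U)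
    (hUB : closedBall 0 R ⊆ U) {G : EuclideanSpace ℝ (Fin n) → EuclideanSpace ℝ (Fin n)}
    (hG : ContDiffOn ℝ 1 G U) (hpos : ∀ x ∈ sphere 0 R, 0 < ⟪x, G x⟫) :
    0 ≤ ∫ x in ball 0 R, dvg G x := by
  have hGc : ContinuousOn G (closedBall 0 R) := hG.continuousOn.mono hUB
  obtain ⟨r, hr0, hrR, hr⟩ := exists_shell_nonneg hR (f := fun x => ⟪x, G x⟫)
    (continuousOn_id.inner hGc) hpos
  have hdc : ContinuousOn (dvg G) (closedBall 0 R) := (continuousOn_dvg hU hG).mono hUB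
  have hdi : IntegrableOn (dvg G) (closedBall 0 R) :=
    hdc.integrableOn_compact (isCompact_closedBall 0 R)
  have hbound : ∀ k (x : EuclideanSpace ℝ (Fin n)), ‖ballCutoff R k x * dvg G x‖ ≤ ‖dvg G x‖ := by
    intro k x
    rw [norm_mul, ballCutoff, Real.norm_of_nonneg (Real.smoothTransition.nonneg _)]
    exact mul_le_of_le_one_left (norm_nonneg _) (Real.smoothTransition.le_one _)
  have hmeas : ∀ k : ℕ, AEStronglyMeasurable (fun x => ballCutoff R k x * dvg G x)
      (volume.restrict (closedBall 0 R)) := fun k =>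
    ((contDiff_ballCutoff k).continuous.continuousOn.mul hdc).aestronglyMeasurable
      measurableSet_closedBall
  have hlim : Tendsto (fun k : ℕ => ∫ x in ball 0 R, ballCutoff R k x * dvg G x) atTop
      (𝓝 (∫ x in ball 0 R, dvg G x)) := by
    have hsub := Measure.restrict_mono (μ := volume) (ball_subset_closedBall (x := 0) (ε := R)
      (α := EuclideanSpace ℝ (Fin n))) le_rfl
    refine tendsto_integral_of_dominated_convergence (fun x => ‖dvg G x‖)
      (fun k => (hmeas k).mono_measure hsub) (hdi.mono_set ball_subset_closedBall).norm
      (fun k => ae_of_all _ (hbound k)) ?_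
    filter_upwards [ae_restrict_mem measurableSet_ball] with x hx
    have hx' : 0 < R ^ 2 - ‖x‖ ^ 2 := by
      have : ‖x‖ < R := by simpa using hx
      nlinarith [norm_nonneg x]
    have hev : ∀ᶠ k : ℕ in atTop, ballCutoff R k x * dvg G x = dvg G x := by
      have := (tendsto_natCast_atTop_atTop (R := ℝ)).atTop_mul_const hx'
      filter_upwards [this.eventually_ge_atTop 1] with k hk
      rw [ballCutoff, Real.smoothTransition.one_of_one_le hk, one_mul]
    exact tendsto_const_nhds.congr' (hev.mono fun _ h => h.symm)
  refine ge_of_tendsto hlim ?_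
  have hrr : 0 < R ^ 2 - r ^ 2 := by nlinarith
  have := (tendsto_natCast_atTop_atTop (R := ℝ)).atTop_mul_const hrr
  filter_upwards [this.eventually_gt_atTop 1] with k hk
  have hsupp : Function.support (fun x => ballCutoff R k x • G x) ⊆ closedBall 0 R := by
    intro x hx
    by_contra h
    exact hx (by simp [ballCutoff_eq_zero hR fun h' => h (ball_subset_closedBall h')])
  have hcd : ContDiff ℝ 1 fun x => ballCutoff R k x • G x := by
    refine contDiff_iff_contDiffAt.2 fun x => ?_
    by_cases hx : x ∈ U
    · exact (contDiff_ballCutoff k).contDiffAt.smul (hG.contDiffAt (hU.mem_nhds hx))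
    · have : (fun x => ballCutoff R k x • G x) =ᶠ[𝓝 x] fun _ => 0 := by
        filter_upwards [isClosed_closedBall.isOpen_compl.mem_nhds fun h => hx (hUB h)] with y hy
        by_contra h
        exact hy (hsupp h)
      exact contDiffAt_const.congr_of_eventuallyEq this
  have hcs : HasCompactSupport fun x => ballCutoff R k x • G x :=
    HasCompactSupport.of_support_subset_isCompact (isCompact_closedBall 0 R) hsupp
  have hz := integral_dvg_eq_zero hcd hcs
  have hts := closure_minimal hsupp isClosed_closedBall
  rw [← setIntegral_eq_integral_of_forall_compl_eq_zero (s := closedBall 0 R) fun x hx => ?_] at hz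
  swap
  · have : fderiv ℝ (fun x => ballCutoff R k x • G x) x = 0 := by
      by_contra h
      exact hx (hts (support_fderiv_subset ℝ h))
    simp [dvg, this]
  rw [← hz, setIntegral_congr_set (ball_ae_eq_closedBall hR)]
  have hHi : IntegrableOn (dvg fun x => ballCutoff R k x • G x) (closedBall 0 R) :=
    ((continuousOn_dvg isOpen_univ hcd.contDiffOn).mono (subset_univ _)).integrableOn_compact
      (isCompact_closedBall 0 R)
  refine setIntegral_mono_on hHi (hdi.norm.mono' (hmeas k) (ae_of_all _ (hbound k)))
    measurableSet_closedBall fun x hx => ?_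
  have hprod : HasFDerivAt (fun x => ballCutoff R k x • G x) _ x :=
    ((contDiff_ballCutoff (R := R) k).differentiable one_ne_zero x).hasFDerivAt.smul
    ((hG.contDiffAt (hU.mem_nhds (hUB hx))).differentiableAt one_ne_zero).hasFDerivAt
  have hsum : dvg (fun x => ballCutoff R k x • G x) x
      = ballCutoff R k x * dvg G x + fderiv ℝ (ballCutoff R k) x (G x) := by
    have hGx : G x = ∑ i, (G x i) • EuclideanSpace.single i (1 : ℝ) := by
      ext j; simp [Finset.sum_apply, Pi.single_apply]
    conv_rhs => rw [hGx]
    rw [hprod.dvg_eq, map_sum, dvg, Finset.mul_sum, ← Finset.sum_add_distrib]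
    refine Finset.sum_congr rfl fun i _ => ?_
    simp [mul_comm]
  rw [hsum, fderiv_ballCutoff]
  have hd : 0 ≤ deriv Real.smoothTransition (k * (R ^ 2 - ‖x‖ ^ 2)) :=
    Real.smoothTransition.monotone.deriv_nonneg
  by_cases hxr : r < ‖x‖
  · have := mul_nonneg hd (mul_nonneg k.cast_nonneg (hr x hx hxr))
    linarith
  · rw [deriv_smoothTransition_of_one_lt]
    · simp
    · refine hk.trans_le (mul_le_mul_of_nonneg_left ?_ k.cast_nonneg)
      nlinarith [norm_nonneg x]

end Ball

section Hopf

variable {n : ℕ}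

lemma lap_eq_dvg {w : EuclideanSpace ℝ (Fin n) → ℝ}
    {G : EuclideanSpace ℝ (Fin n) → EuclideanSpace ℝ (Fin n)} {x : EuclideanSpace ℝ (Fin n)}
    (hw : ∀ᶠ y in 𝓝 x, HasGradientAt w (G y) y) (hG : DifferentiableAt ℝ G x) :
    lap w x = dvg G x := by
  refine Finset.sum_congr rfl fun i _ => ?_
  have h1 : (fun y => fderiv ℝ w y (EuclideanSpace.single i 1)) =ᶠ[𝓝 x] fun y => G y i := by
    filter_upwards [hw] with y hy
    rw [hy.hasFDerivAt.fderiv, InnerProductSpace.toDual_apply_apply,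
      EuclideanSpace.inner_single_right]
    simp
  have h2 : HasFDerivAt (fun y => G y i)
      ((EuclideanSpace.proj i : EuclideanSpace ℝ (Fin n) →L[ℝ] ℝ).comp (fderiv ℝ G x)) x :=
    (EuclideanSpace.proj i : EuclideanSpace ℝ (Fin n) →L[ℝ] ℝ).hasFDerivAt.comp x hG.hasFDerivAt
  rw [h1.fderiv_eq, h2.fderiv]
  rfl

lemma IsLocalMin.deriv_deriv_nonneg {g : ℝ → ℝ} {t : ℝ} (h : IsLocalMin g t)
    (hc : ContinuousAt g t) : 0 ≤ deriv (deriv g) t := by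
  by_contra! hneg
  have hmax := isLocalMax_of_deriv_deriv_neg hneg h.deriv_eq_zero hc
  have hconst : g =ᶠ[𝓝 t] fun _ => g t := by
    filter_upwards [h, hmax] with s h1 h2 using le_antisymm h2 h1
  have := hconst.deriv.deriv_eq
  simp at this
  exact hneg.ne this

lemma IsLocalMin.lap_nonneg {w : EuclideanSpace ℝ (Fin n) → ℝ} {x : EuclideanSpace ℝ (Fin n)}
    (h : IsLocalMin w x) (hw : ContDiffAt ℝ 2 w x) : 0 ≤ lap w x := by
  refine Finset.sum_nonneg fun i _ => ?_
  set e : EuclideanSpace ℝ (Fin n) := EuclideanSpace.single i 1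
  have hline : ∀ t : ℝ, HasDerivAt (fun t : ℝ => x + t • e) e t := fun t => by
    simpa using ((hasDerivAt_id t).smul_const e).const_add x
  have hx0 : x + (0 : ℝ) • e = x := by simp
  have htend : Tendsto (fun t : ℝ => x + t • e) (𝓝 0) (𝓝 x) := by
    simpa [hx0] using (hline 0).continuousAt.tendsto
  have hd : ∀ᶠ y in 𝓝 x, DifferentiableAt ℝ w y :=
    (hw.eventually (by simp)).mono fun y hy => hy.differentiableAt two_ne_zero
  have hg : deriv (fun t : ℝ => w (x + t • e)) =ᶠ[𝓝 0] fun t => fderiv ℝ w (x + t • e) e := by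
    filter_upwards [htend.eventually hd] with t ht
    exact (ht.hasFDerivAt.comp_hasDerivAt t (hline t)).deriv
  have hf : DifferentiableAt ℝ (fun y => fderiv ℝ w y e) x :=
    ((hw.fderiv_right (m := 1) le_rfl).differentiableAt one_ne_zero).clm_apply
      (differentiableAt_const e)
  have hdd : deriv (deriv fun t : ℝ => w (x + t • e)) 0
      = fderiv ℝ (fun y => fderiv ℝ w y e) x e := by
    rw [hg.deriv_eq]
    exact (HasFDerivAt.comp_hasDerivAt (0 : ℝ) (by simpa using hf.hasFDerivAt) (hline 0)).deriv
  rw [← hdd]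
  refine IsLocalMin.deriv_deriv_nonneg ?_ ?_
  · have := htend.eventually h
    simpa [IsLocalMin, IsMinFilter] using this
  · exact ContinuousAt.comp (g := w) (by simpa using hw.continuousAt) (hline 0).continuousAt

lemma hasGradientAt_sub_barrier {u : EuclideanSpace ℝ (Fin n) → ℝ} {R K ε : ℝ}
    {x : EuclideanSpace ℝ (Fin n)} (hu : DifferentiableAt ℝ u x) :
    HasGradientAt (fun y => u y - ε * ((R ^ 2 - ‖y‖ ^ 2) + K * (R ^ 2 - ‖y‖ ^ 2) ^ 2))
      (gradient u x + (ε * (2 * (1 + 2 * K * (R ^ 2 - ‖x‖ ^ 2)))) • x) x := by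
  have hs : HasFDerivAt (fun y : EuclideanSpace ℝ (Fin n) => R ^ 2 - ‖y‖ ^ 2) _ x :=
    (hasStrictFDerivAt_norm_sq x).hasFDerivAt.const_sub (R ^ 2)
  rw [hasGradientAt_iff_hasFDerivAt]
  refine (hu.hasGradientAt.hasFDerivAt.sub
    ((hs.add ((hs.pow 2).const_mul K)).const_mul ε)).congr_fderiv ?_
  ext y
  simp
  ring

lemma lap_sub_barrier {u : EuclideanSpace ℝ (Fin n) → ℝ} {R K ε : ℝ}
    {x : EuclideanSpace ℝ (Fin n)} (hu : ContDiffAt ℝ 2 u x) :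
    lap (fun y => u y - ε * ((R ^ 2 - ‖y‖ ^ 2) + K * (R ^ 2 - ‖y‖ ^ 2) ^ 2)) x
      = lap u x - ε * (8 * K * ‖x‖ ^ 2 - 2 * n * (1 + 2 * K * (R ^ 2 - ‖x‖ ^ 2))) := by
  have hd : ∀ᶠ y in 𝓝 x, DifferentiableAt ℝ u y :=
    (hu.eventually (by simp)).mono fun y hy => hy.differentiableAt two_ne_zero
  have hgrad : DifferentiableAt ℝ (gradient u) x :=
    (InnerProductSpace.toDual ℝ (EuclideanSpace ℝ (Fin n))).symm.differentiableAt.comp x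
      ((hu.fderiv_right (m := 1) le_rfl).differentiableAt one_ne_zero)
  have hs : HasFDerivAt (fun y : EuclideanSpace ℝ (Fin n) => R ^ 2 - ‖y‖ ^ 2) _ x :=
    (hasStrictFDerivAt_norm_sq x).hasFDerivAt.const_sub (R ^ 2)
  have hG : HasFDerivAt (fun y => gradient u y
      + (ε * (2 * (1 + 2 * K * (R ^ 2 - ‖y‖ ^ 2)))) • y) _ x := hgrad.hasFDerivAt.add
    (((((hs.const_mul (2 * K)).const_add 1).const_mul 2).const_mul ε).smul (hasFDerivAt_id x))
  rw [lap_eq_dvg (hd.mono fun y hy => hasGradientAt_sub_barrier hy) hG.differentiableAt,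
    lap_eq_dvg (hd.mono fun y hy => hy.hasGradientAt) hgrad, hG.dvg_eq, dvg]
  have hnorm : ‖x‖ ^ 2 = ∑ i, x i * x i := by
    rw [EuclideanSpace.real_norm_sq_eq]
    simp [sq]
  simp [Finset.sum_add_distrib, EuclideanSpace.inner_single_right, mul_add, mul_sub,
    Finset.mul_sum, hnorm]
  ring_nf

/-- Hopf's boundary point lemma on a ball centered at the origin. -/
lemma inner_gradient_neg_of_mem_sphere {R : ℝ} (hR : 0 < R) {U : Set (EuclideanSpace ℝ (Fin n))}
    (hU : IsOpen U) (hUB : closedBall 0 R ⊆ U) {u : EuclideanSpace ℝ (Fin n) → ℝ}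
    (hu : ContDiffOn ℝ 2 u U) {C : ℝ} (hC : 0 ≤ C) (hle : ∀ x ∈ ball 0 R, lap u x ≤ C * u x)
    (hpos : ∀ x ∈ ball 0 R, 0 < u x) (hb : ∀ x ∈ sphere 0 R, u x = 0)
    {x₀ : EuclideanSpace ℝ (Fin n)} (hx₀ : x₀ ∈ sphere 0 R) : ⟪x₀, gradient u x₀⟫ < 0 := by
  have hnx₀ : ‖x₀‖ = R := by simpa using hx₀
  have hcu : ContinuousOn u (closedBall 0 R) := hu.continuousOn.mono hUB
  have hR2 : 0 < R ^ 2 := by positivity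
  obtain ⟨K, hK, hKR⟩ : ∃ K : ℝ, 0 ≤ K ∧ K * R ^ 2 = n + 1 :=
    ⟨(n + 1) / R ^ 2, by positivity, by field_simp⟩
  obtain ⟨δ, hδ, hδ1, hδR, hδM⟩ : ∃ δ : ℝ, 0 < δ ∧ δ ≤ 1 ∧ δ < R ^ 2 ∧
      δ * (4 * n * K + 8 * K + C + C * K) ≤ 1 := by
    have hM : 0 ≤ 4 * n * K + 8 * K + C + C * K := by positivity
    refine ⟨min (min 1 (R ^ 2 / 2)) (1 / (4 * n * K + 8 * K + C + C * K + 1)), by positivity,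
      (min_le_left _ _).trans (min_le_left _ _),
      ((min_le_left _ _).trans (min_le_right _ _)).trans_lt (by linarith), ?_⟩
    refine (mul_le_mul_of_nonneg_right (min_le_right _ _) hM).trans ?_
    rw [one_div_mul_eq_div, div_le_one (by positivity)]
    linarith
  set s : EuclideanSpace ℝ (Fin n) → ℝ := fun x => R ^ 2 - ‖x‖ ^ 2 with hs
  have hsc : Continuous s := by fun_prop
  obtain ⟨m, hm, hmu⟩ : ∃ m, 0 < m ∧ ∀ x ∈ closedBall 0 R, s x = δ → m ≤ u x := by
    have hcomp : IsCompact (closedBall 0 R ∩ s ⁻¹' {δ}) :=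
      (isCompact_closedBall 0 R).inter_right (isClosed_singleton.preimage hsc)
    rcases (closedBall 0 R ∩ s ⁻¹' {δ}).eq_empty_or_nonempty with hE | hne
    · exact ⟨1, one_pos, fun x hx hxs => ((Set.ext_iff.1 hE x).1 ⟨hx, hxs⟩).elim⟩
    · obtain ⟨z, ⟨hz, hzs⟩, hmin⟩ := hcomp.exists_isMinOn hne (hcu.mono inter_subset_left)
      refine ⟨u z, hpos z ?_, fun x hx hxs => hmin ⟨hx, hxs⟩⟩
      have hzs' : R ^ 2 - ‖z‖ ^ 2 = δ := hzs
      rw [mem_ball_zero_iff]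
      exact lt_of_pow_lt_pow_left₀ 2 hR.le (by linarith)
  obtain ⟨ε, hε, hεm⟩ : ∃ ε : ℝ, 0 < ε ∧ ε * (δ + K * δ ^ 2) = m :=
    ⟨m / (δ + K * δ ^ 2), by positivity, by field_simp⟩
  set w : EuclideanSpace ℝ (Fin n) → ℝ := fun x => u x - ε * (s x + K * s x ^ 2) with hw
  set A := closedBall 0 R ∩ s ⁻¹' Iic δ
  have hAc : IsCompact A := (isCompact_closedBall 0 R).inter_right (isClosed_Iic.preimage hsc)
  have hsx₀ : s x₀ = 0 := by simp [hs, hnx₀]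
  have hx₀A : x₀ ∈ A := ⟨sphere_subset_closedBall hx₀, by simp [hsx₀, hδ.le]⟩
  have hwx₀ : w x₀ = 0 := by simp [hw, hsx₀, hb x₀ hx₀]
  have hwc : ContinuousOn w A := (hcu.mono inter_subset_left).sub (by fun_prop)
  have hwA : ∀ x ∈ A, 0 ≤ w x := by
    obtain ⟨z, ⟨hzB, hzs⟩, hmin⟩ := hAc.exists_isMinOn ⟨x₀, hx₀A⟩ hwc
    refine fun x hx => le_trans ?_ (hmin hx)
    by_contra! hneg
    have hzR : ‖z‖ ≠ R := fun h => by
      simp [hw, hs, h, hb z (by simpa using h)] at hneg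
    have hzlt : ‖z‖ < R := lt_of_le_of_ne (by simpa using hzB) hzR
    have hzball : z ∈ ball 0 R := by simpa using hzlt
    have hzδ : s z ≠ δ := fun h => by
      have h1 := hmu z hzB h
      have h2 : w z = u z - m := by simp only [hw, h, hεm]
      linarith
    have hszlt : s z < δ := lt_of_le_of_ne hzs hzδ
    have hszpos : 0 < s z := by
      simp only [hs]
      nlinarith [norm_nonneg z]
    have hloc : IsLocalMin w z := hmin.isLocalMin (inter_mem
      (mem_of_superset (isOpen_ball.mem_nhds hzball) ball_subset_closedBall)
      (hsc.continuousAt.eventually (Iic_mem_nhds hszlt)))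
    have huz : ContDiffAt ℝ 2 u z := hu.contDiffAt (hU.mem_nhds (hUB hzB))
    have hwz : ContDiffAt ℝ 2 w z := by
      have : ContDiff ℝ 2 s := contDiff_const.sub (contDiff_norm_sq ℝ)
      exact huz.sub (by fun_prop)
    have hlap := hloc.lap_nonneg hwz
    rw [hw, lap_sub_barrier huz] at hlap
    have hnz : ‖z‖ ^ 2 = R ^ 2 - s z := by simp [hs]
    have hsz : R ^ 2 - ‖z‖ ^ 2 = s z := rfl
    rw [hsz, hnz] at hlap
    have hkey : C * (s z + K * s z ^ 2)
        < 8 * K * (R ^ 2 - s z) - 2 * n * (1 + 2 * K * s z) := by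
      have h1 : s z * (4 * n * K + 8 * K + C + C * K) ≤ 1 :=
        (mul_le_mul_of_nonneg_right hszlt.le (by positivity)).trans hδM
      have h2 : s z ^ 2 ≤ s z := by nlinarith
      have h3 : C * K * s z ^ 2 ≤ C * K * s z := mul_le_mul_of_nonneg_left h2 (by positivity)
      have h4 : (0 : ℝ) ≤ n := n.cast_nonneg
      nlinarith
    have h5 := mul_lt_mul_of_pos_left hkey hε
    have h6 := hle z hzball
    have h7 : C * w z ≤ 0 := mul_nonpos_of_nonneg_of_nonpos hC hneg.le
    simp only [hw] at h7
    nlinarith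
  have hmin : IsMinOn w A x₀ := fun x hx => by simpa [hwx₀] using hwA x hx
  have hgrad := hasGradientAt_sub_barrier (R := R) (K := K) (ε := ε)
    ((hu.contDiffAt (hU.mem_nhds (hUB (sphere_subset_closedBall hx₀)))).differentiableAt
      two_ne_zero)
  set τ := δ / (2 * R ^ 2) with hτ
  have hτ0 : 0 < τ := by positivity
  have hτ1 : τ ≤ 1 := by
    rw [hτ, div_le_one (by positivity)]
    linarith
  have hτR : 2 * R ^ 2 * τ = δ := by rw [hτ]; field_simp
  have hseg : segment ℝ x₀ (x₀ + -(τ • x₀)) ⊆ A := by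
    rw [segment_eq_image']
    rintro _ ⟨θ, ⟨hθ0, hθ1⟩, rfl⟩
    have hθτ : 0 ≤ θ * τ := by positivity
    have hθτ1 : θ * τ ≤ τ := mul_le_of_le_one_left hτ0.le hθ1
    have hx : x₀ + θ • (x₀ + -(τ • x₀) - x₀) = (1 - θ * τ) • x₀ := by module
    have hnx : ‖x₀ + θ • (x₀ + -(τ • x₀) - x₀)‖ = (1 - θ * τ) * R := by
      rw [hx, norm_smul, hnx₀, Real.norm_of_nonneg (by linarith)]
    constructor
    · rw [mem_closedBall_zero_iff, hnx]
      nlinarith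
    · simp only [hs, mem_preimage, mem_Iic]
      rw [hnx]
      nlinarith [mul_le_mul_of_nonneg_left hθτ1 hR2.le, mul_nonneg hR2.le (sq_nonneg (θ * τ))]
  have hnn := hmin.localize.hasFDerivWithinAt_nonneg hgrad.hasFDerivAt.hasFDerivWithinAt
    (mem_posTangentConeAt_of_segment_subset hseg)
  have hval : 0 ≤ -(τ * (⟪x₀, gradient u x₀⟫ + ε * 2 * R ^ 2)) := by
    convert hnn using 1
    simp [hnx₀, real_inner_smul_right]
    ring
  have h1 : ⟪x₀, gradient u x₀⟫ + ε * 2 * R ^ 2 ≤ 0 := by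
    by_contra! h
    have := mul_pos hτ0 h
    linarith
  have h2 : 0 < ε * 2 * R ^ 2 := by positivity
  linarith

/-- The gradient of a function vanishing on a sphere is radial there. -/
lemma exists_gradient_eq_smul {R : ℝ} (hR : 0 < R) {u : EuclideanSpace ℝ (Fin n) → ℝ}
    (hb : ∀ x ∈ sphere 0 R, u x = 0) {x₀ : EuclideanSpace ℝ (Fin n)} (hx₀ : x₀ ∈ sphere 0 R)
    (hu : ContDiffAt ℝ 1 u x₀) : ∃ c : ℝ, gradient u x₀ = c • x₀ := by
  have hnx₀ : ‖x₀‖ = R := by simpa using hx₀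
  have hext : IsLocalExtrOn u {x | ‖x‖ ^ 2 = ‖x₀‖ ^ 2} x₀ := by
    refine Or.inl (IsMinOn.localize fun x hx => ?_)
    have : ‖x‖ = R := by
      rw [← hnx₀]
      exact (pow_left_inj₀ (norm_nonneg _) (norm_nonneg _) two_ne_zero).1 hx
    simp [hb x (by simpa using this), hb x₀ hx₀]
  obtain ⟨a, b, hab, h⟩ := hext.exists_multipliers_of_hasStrictFDerivAt_1d
    (hasStrictFDerivAt_norm_sq x₀) (hu.hasStrictFDerivAt one_ne_zero)
  have happ : ∀ y, a * (2 * ⟪x₀, y⟫) + b * ⟪gradient u x₀, y⟫ = 0 := fun y => by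
    have := congrArg (fun L : EuclideanSpace ℝ (Fin n) →L[ℝ] ℝ => L y) h
    simpa using this
  have hb0 : b ≠ 0 := by
    rintro rfl
    have h1 := happ x₀
    have h2 : a = 0 := by simpa [hnx₀, hR.ne', norm_ne_zero_iff.1 (hnx₀ ▸ hR.ne')] using h1
    exact hab (by simp [h2])
  refine ⟨-(2 * a) / b, ext_inner_right ℝ fun y => ?_⟩
  rw [real_inner_smul_left]
  field_simp
  linarith [happ y]

end Hopf

section Pohozaev

variable {n : ℕ}

/-- The Rellich–Pohožaev vector field of a pair of functions. -/
def pohozaevField (u v : EuclideanSpace ℝ (Fin n) → ℝ) (x : EuclideanSpace ℝ (Fin n)) :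
    EuclideanSpace ℝ (Fin n) :=
  ⟪x, gradient u x⟫ • gradient v x + ⟪x, gradient v x⟫ • gradient u x
    - ⟪gradient u x, gradient v x⟫ • x

lemma ContDiffAt.gradient {u : EuclideanSpace ℝ (Fin n) → ℝ} {x : EuclideanSpace ℝ (Fin n)}
    (hu : ContDiffAt ℝ 2 u x) : ContDiffAt ℝ 1 (gradient u) x :=
  (InnerProductSpace.toDual ℝ (EuclideanSpace ℝ (Fin n))).symm.contDiff.contDiffAt.comp x
    (hu.fderiv_right (m := 1) le_rfl)

lemma ContDiffAt.inner_fderiv_gradient_comm {u : EuclideanSpace ℝ (Fin n) → ℝ}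
    {x : EuclideanSpace ℝ (Fin n)} (hu : ContDiffAt ℝ 2 u x) (a b : EuclideanSpace ℝ (Fin n)) :
    ⟪fderiv ℝ (_root_.gradient u) x a, b⟫ = ⟪a, fderiv ℝ (_root_.gradient u) x b⟫ := by
  have hsymm := hu.isSymmSndFDerivAt (by simp)
  have hval : ∀ a b, ⟪fderiv ℝ (_root_.gradient u) x a, b⟫ = fderiv ℝ (fderiv ℝ u) x a b := by
    intro a b
    have h := ((InnerProductSpace.toDual ℝ (EuclideanSpace ℝ (Fin n))).symm.toContinuousLinearEquiv
      |>.toContinuousLinearMap).hasFDerivAt.comp x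
      ((hu.fderiv_right (m := 1) le_rfl).differentiableAt one_ne_zero).hasFDerivAt
    have h' : fderiv ℝ (_root_.gradient u) x = _ := h.fderiv
    rw [h']
    exact InnerProductSpace.toDual_symm_apply
  rw [hval, hsymm.eq, ← hval, real_inner_comm]

lemma contDiffAt_pohozaevField {u v : EuclideanSpace ℝ (Fin n) → ℝ}
    {x : EuclideanSpace ℝ (Fin n)} (hu : ContDiffAt ℝ 2 u x) (hv : ContDiffAt ℝ 2 v x) :
    ContDiffAt ℝ 1 (pohozaevField u v) x :=
  (((contDiffAt_id.inner ℝ hu.gradient).smul hv.gradient).add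
    ((contDiffAt_id.inner ℝ hv.gradient).smul hu.gradient)).sub
    ((hu.gradient.inner ℝ hv.gradient).smul contDiffAt_id)

lemma lap_eq_sum_fderiv_gradient {u : EuclideanSpace ℝ (Fin n) → ℝ}
    {x : EuclideanSpace ℝ (Fin n)} (hu : ContDiffAt ℝ 2 u x) :
    lap u x = ∑ i, fderiv ℝ (gradient u) x (EuclideanSpace.single i 1) i :=
  lap_eq_dvg ((hu.eventually (by simp)).mono fun _ hy =>
    (hy.differentiableAt two_ne_zero).hasGradientAt) (hu.gradient.differentiableAt one_ne_zero)

lemma dvg_pohozaevField {u v : EuclideanSpace ℝ (Fin n) → ℝ}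
    {x : EuclideanSpace ℝ (Fin n)} (hu : ContDiffAt ℝ 2 u x) (hv : ContDiffAt ℝ 2 v x) :
    dvg (pohozaevField u v) x = lap u x * ⟪x, gradient v x⟫ + lap v x * ⟪x, gradient u x⟫
        - ((n : ℝ) - 2) * ⟪gradient u x, gradient v x⟫ := by
  have ha := (hu.gradient.differentiableAt one_ne_zero).hasFDerivAt
  have hb := (hv.gradient.differentiableAt one_ne_zero).hasFDerivAt
  have hF : HasFDerivAt (pohozaevField u v) _ x :=
    ((((hasFDerivAt_id x).inner ℝ ha).smul hb).add (((hasFDerivAt_id x).inner ℝ hb).smul ha)).sub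
      ((ha.inner ℝ hb).smul (hasFDerivAt_id x))
  have hexp : ∀ (L : EuclideanSpace ℝ (Fin n) →L[ℝ] ℝ) (y : EuclideanSpace ℝ (Fin n)),
      ∑ i, L (EuclideanSpace.single i 1) * y i = L y := by
    intro L y
    have hy : y = ∑ i, (y i) • EuclideanSpace.single i (1 : ℝ) := by
      ext j; simp [Finset.sum_apply, Pi.single_apply]
    conv_rhs => rw [hy]
    simp [mul_comm]
  rw [hF.dvg_eq, lap_eq_sum_fderiv_gradient hu, lap_eq_sum_fderiv_gradient hv]
  set a := gradient u x
  set b := gradient v x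
  set A := fderiv ℝ (gradient u) x
  set B := fderiv ℝ (gradient v) x
  have h1 := hexp ((innerSL ℝ x).comp A + innerSL ℝ a) b
  have h2 := hexp ((innerSL ℝ x).comp B + innerSL ℝ b) a
  have h3 := hexp ((innerSL ℝ a).comp B + (innerSL ℝ b).comp A) x
  have h4 : ⟪b, A x⟫ = ⟪x, A b⟫ := by rw [real_inner_comm, hu.inner_fderiv_gradient_comm]
  have h5 : ⟪a, B x⟫ = ⟪x, B a⟫ := by rw [real_inner_comm, hv.inner_fderiv_gradient_comm]
  have h6 : ⟪b, a⟫ = ⟪a, b⟫ := real_inner_comm _ _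
  simp only [add_apply, ContinuousLinearMap.comp_apply, innerSL_apply_apply,
    add_mul, Finset.sum_add_distrib] at h1 h2 h3
  have h7 : ∀ i, ⟪EuclideanSpace.single i (1 : ℝ), a⟫ = ⟪a, EuclideanSpace.single i (1 : ℝ)⟫ :=
    fun _ => real_inner_comm _ _
  have h8 : ∀ i, ⟪EuclideanSpace.single i (1 : ℝ), b⟫ = ⟪b, EuclideanSpace.single i (1 : ℝ)⟫ :=
    fun _ => real_inner_comm _ _
  have h9 : ∀ y, ⟪A y, b⟫ = ⟪b, A y⟫ := fun _ => real_inner_comm _ _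
  simp [Finset.sum_add_distrib]
  simp only [h7, h8, h9, add_mul, Finset.sum_add_distrib, ← Finset.mul_sum]
  linarith

end Pohozaev

/-- **Positivity of the Rellich-Pohozaev cross term** for solutions of the Dirichlet problem
of the system `-Δu = v^p - u^p`, `-Δv = u^p` on the ball of radius `R`. -/
theorem pohozaev_cross_term_positive (n : ℕ) (hn : 3 ≤ n) (p : ℝ) (hp : 1 < p)
    (R : ℝ) (hR : 0 < R)
    (u v : EuclideanSpace ℝ (Fin n) → ℝ) (U : Set (EuclideanSpace ℝ (Fin n)))
    (hU : IsOpen U) (hUB : closedBall (0 : EuclideanSpace ℝ (Fin n)) R ⊆ U)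
    (hu : ContDiffOn ℝ 2 u U) (hv : ContDiffOn ℝ 2 v U)
    (hequ : ∀ x ∈ ball (0 : EuclideanSpace ℝ (Fin n)) R, - lap u x = v x ^ p - u x ^ p)
    (heqv : ∀ x ∈ ball (0 : EuclideanSpace ℝ (Fin n)) R, - lap v x = u x ^ p)
    (hupos : ∀ x ∈ ball (0 : EuclideanSpace ℝ (Fin n)) R, 0 < u x)
    (hvpos : ∀ x ∈ ball (0 : EuclideanSpace ℝ (Fin n)) R, 0 < v x)
    (hub : ∀ x ∈ sphere (0 : EuclideanSpace ℝ (Fin n)) R, u x = 0)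
    (hvb : ∀ x ∈ sphere (0 : EuclideanSpace ℝ (Fin n)) R, v x = 0) :
    0 < ∫ x in ball (0 : EuclideanSpace ℝ (Fin n)) R,
      (lap u x * ⟪x, gradient v x⟫ + lap v x * ⟪x, gradient u x⟫
        - ((n:ℝ) - 2) * ⟪gradient u x, gradient v x⟫) := by
  have hnhds : ∀ x ∈ closedBall (0 : EuclideanSpace ℝ (Fin n)) R, U ∈ 𝓝 x :=
    fun x hx => hU.mem_nhds (hUB hx)
  have hne : Nonempty (Fin n) := ⟨⟨0, by lia⟩⟩
  have hFs : ∀ x ∈ sphere (0 : EuclideanSpace ℝ (Fin n)) R, 0 < ⟪x, pohozaevField u v x⟫ := by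
    obtain ⟨M, hM⟩ := ((isCompact_closedBall 0 R).image_of_continuousOn
      (hu.continuousOn.mono hUB)).bddAbove
    have huM : ∀ x ∈ ball (0 : EuclideanSpace ℝ (Fin n)) R, u x ≤ M := fun x hx =>
      hM (mem_image_of_mem u (ball_subset_closedBall hx))
    have hM0 : 0 ≤ M := (hupos 0 (by simpa using hR)).le.trans (huM 0 (by simpa using hR))
    intro x hx
    have hxB := sphere_subset_closedBall hx
    have hu' : ⟪x, gradient u x⟫ < 0 := by
      refine inner_gradient_neg_of_mem_sphere hR hU hUB hu (Real.rpow_nonneg hM0 (p - 1))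
        (fun y hy => ?_) hupos hub hx
      have h1 := Real.rpow_le_rpow (hupos y hy).le (huM y hy) (sub_nonneg.2 hp.le)
      have h2 := mul_le_mul_of_nonneg_right h1 (hupos y hy).le
      rw [← Real.rpow_add_one (hupos y hy).ne', sub_add_cancel] at h2
      linarith [hequ y hy, Real.rpow_nonneg (hvpos y hy).le p]
    have hv' : ⟪x, gradient v x⟫ < 0 :=
      inner_gradient_neg_of_mem_sphere hR hU hUB hv le_rfl
        (fun y hy => by linarith [heqv y hy, Real.rpow_nonneg (hupos y hy).le p]) hvpos hvb hx
    obtain ⟨c, hc⟩ := exists_gradient_eq_smul hR hub hx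
      ((hu.contDiffAt (hnhds x hxB)).of_le one_le_two)
    have hmul : ⟪gradient u x, gradient v x⟫ * ⟪x, x⟫ = ⟪x, gradient u x⟫ * ⟪x, gradient v x⟫ := by
      rw [hc, real_inner_smul_left, real_inner_smul_right]
      ring
    rw [pohozaevField, inner_sub_right, inner_add_right, real_inner_smul_right,
      real_inner_smul_right, real_inner_smul_right, hmul]
    linarith [mul_pos_of_neg_of_neg hu' hv']
  have hF : ContDiffOn ℝ 1 (pohozaevField u v) U := fun x hx =>
    (contDiffAt_pohozaevField (hu.contDiffAt (hU.mem_nhds hx))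
      (hv.contDiffAt (hU.mem_nhds hx))).contDiffWithinAt
  have hnt : (sphere (0 : EuclideanSpace ℝ (Fin n)) R).Nonempty := by
    rw [NormedSpace.sphere_nonempty]
    exact hR.le
  obtain ⟨z, hz, hmin⟩ := (isCompact_sphere (0 : EuclideanSpace ℝ (Fin n)) R).exists_isMinOn hnt
    (f := fun x => ⟪x, pohozaevField u v x⟫)
    (continuousOn_id.inner (hF.continuousOn.mono (sphere_subset_closedBall.trans hUB)))
  obtain ⟨κ, hκ, hκz⟩ : ∃ κ : ℝ, 0 < κ ∧ κ * R ^ 2 < ⟪z, pohozaevField u v z⟫ := by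
    have := hFs z hz
    refine ⟨⟪z, pohozaevField u v z⟫ / (2 * R ^ 2), by positivity, ?_⟩
    field_simp
    linarith
  have hG : ContDiffOn ℝ 1 (fun x => pohozaevField u v x - κ • x) U :=
    hF.sub (contDiffOn_id.const_smul κ)
  have hGnn := integral_dvg_nonneg hR hU hUB hG fun x hx => by
    have h1 : ⟪z, pohozaevField u v z⟫ ≤ ⟪x, pohozaevField u v x⟫ := hmin hx
    have h2 : ‖x‖ = R := by simpa using hx
    rw [inner_sub_right, real_inner_smul_right, real_inner_self_eq_norm_sq, h2]
    linarith
  have hdvg : ∀ x ∈ ball (0 : EuclideanSpace ℝ (Fin n)) R,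
      dvg (fun x => pohozaevField u v x - κ • x) x = dvg (pohozaevField u v) x - κ * n := by
    intro x hx
    have h1 := ((hF.contDiffAt (hnhds x (ball_subset_closedBall hx))).differentiableAt
      one_ne_zero).hasFDerivAt
    have h2 : HasFDerivAt (fun x => pohozaevField u v x - κ • x) _ x :=
      h1.sub ((hasFDerivAt_id x).const_smul κ)
    rw [h2.dvg_eq, dvg]
    simp [mul_comm]
  have hint : IntegrableOn (dvg (pohozaevField u v)) (ball 0 R) :=
    (((continuousOn_dvg hU hF).mono hUB).integrableOn_compact
      (isCompact_closedBall 0 R)).mono_set ball_subset_closedBall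
  have hvol : 0 < volume.real (ball (0 : EuclideanSpace ℝ (Fin n)) R) :=
    ENNReal.toReal_pos (measure_ball_pos volume 0 hR).ne' measure_ball_lt_top.ne
  rw [setIntegral_congr_fun measurableSet_ball hdvg, integral_sub hint
    (integrableOn_const measure_ball_lt_top.ne), setIntegral_const, smul_eq_mul] at hGnn
  have hn0 : (0 : ℝ) < n := by exact_mod_cast (by lia : 0 < n)
  rw [← setIntegral_congr_fun measurableSet_ball fun x hx =>
    dvg_pohozaevField (hu.contDiffAt (hnhds x (ball_subset_closedBall hx)))
      (hv.contDiffAt (hnhds x (ball_subset_closedBall hx)))]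
  have := mul_pos hvol (mul_pos hκ hn0)
  linarith
end
end

section
/- Let n ≥ 3, let p > 1 be a real number, and let R > 0. Suppose u, v are twice continuously differentiable on a neighborhood of the closed ball B̄_R ⊂ ℝ^n with −Δu = v^p − u^p and −Δv = u^p in B_R, u > 0 and v > 0 in B_R, and u = v = 0 on ∂B_R. Then ∫_{B_R} (n/(p+1) − (n−2)/2) (u(x)^{p+1} + v(x)^{p+1}) dx > 0. -/
noncomputable section
open Set Metric
open scoped BigOperators

open MeasureTheory Filter Topology

/-- The partial derivative of `f` in the `i`-th coordinate direction. -/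
def partialDeriv {n : ℕ} (i : Fin n) (f : EuclideanSpace ℝ (Fin n) → ℝ)
    (x : EuclideanSpace ℝ (Fin n)) : ℝ :=
  fderiv ℝ f x (EuclideanSpace.single i 1)

/-- The divergence of a vector field given by its components. -/
def divergence {n : ℕ} (Y : Fin n → EuclideanSpace ℝ (Fin n) → ℝ)
    (x : EuclideanSpace ℝ (Fin n)) : ℝ :=
  ∑ i, partialDeriv i (Y i) x

/-- The bilinear vector field `(x·∇w)∇z + (x·∇z)∇w - (∇w·∇z)x`. -/
def rellichField {n : ℕ} (w z : EuclideanSpace ℝ (Fin n) → ℝ) (i : Fin n)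
    (x : EuclideanSpace ℝ (Fin n)) : ℝ :=
  (∑ j, x j * partialDeriv j w x) * partialDeriv i z x
    + (∑ j, x j * partialDeriv j z x) * partialDeriv i w x
    - (∑ j, partialDeriv j w x * partialDeriv j z x) * x i

section PartialDeriv

variable {n : ℕ} {f g : EuclideanSpace ℝ (Fin n) → ℝ} {x : EuclideanSpace ℝ (Fin n)}

theorem lap_eq_divergence : lap f x = divergence (fun i => partialDeriv i f) x := rfl

theorem fderiv_apply_eq_sum (f : EuclideanSpace ℝ (Fin n) → ℝ) (x h : EuclideanSpace ℝ (Fin n)) :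
    fderiv ℝ f x h = ∑ i, h i * partialDeriv i f x := by
  conv_lhs => rw [← (EuclideanSpace.basisFun (Fin n) ℝ).sum_repr h]
  simp [partialDeriv]

theorem partialDeriv_add (hf : DifferentiableAt ℝ f x) (hg : DifferentiableAt ℝ g x) (i : Fin n) :
    partialDeriv i (fun y => f y + g y) x = partialDeriv i f x + partialDeriv i g x := by
  simp [partialDeriv, fderiv_fun_add hf hg]

theorem partialDeriv_sub (hf : DifferentiableAt ℝ f x) (hg : DifferentiableAt ℝ g x) (i : Fin n) :
    partialDeriv i (fun y => f y - g y) x = partialDeriv i f x - partialDeriv i g x := by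
  simp [partialDeriv, fderiv_fun_sub hf hg]

theorem partialDeriv_mul (hf : DifferentiableAt ℝ f x) (hg : DifferentiableAt ℝ g x) (i : Fin n) :
    partialDeriv i (fun y => f y * g y) x
      = partialDeriv i f x * g x + f x * partialDeriv i g x := by
  simp [partialDeriv, fderiv_fun_mul hf hg]; ring

theorem partialDeriv_sum {F : Fin n → EuclideanSpace ℝ (Fin n) → ℝ}
    (hF : ∀ j, DifferentiableAt ℝ (F j) x) (i : Fin n) :
    partialDeriv i (fun y => ∑ j, F j y) x = ∑ j, partialDeriv i (F j) x := by
  simp [partialDeriv, fderiv_fun_sum (fun j _ => hF j)]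

theorem hasFDerivAt_coord (x : EuclideanSpace ℝ (Fin n)) (j : Fin n) :
    HasFDerivAt (fun y : EuclideanSpace ℝ (Fin n) => y j)
      (EuclideanSpace.proj j : EuclideanSpace ℝ (Fin n) →L[ℝ] ℝ) x :=
  (EuclideanSpace.proj j : EuclideanSpace ℝ (Fin n) →L[ℝ] ℝ).hasFDerivAt

theorem differentiableAt_coord (j : Fin n) :
    DifferentiableAt ℝ (fun y : EuclideanSpace ℝ (Fin n) => y j) x :=
  (hasFDerivAt_coord x j).differentiableAt

theorem partialDeriv_coord (i j : Fin n) :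
    partialDeriv i (fun y : EuclideanSpace ℝ (Fin n) => y j) x = if j = i then 1 else 0 := by
  simp [partialDeriv, (hasFDerivAt_coord x j).fderiv]

theorem partialDeriv_rpow {q : ℝ} (hf : DifferentiableAt ℝ f x) (hx : f x ≠ 0) (i : Fin n) :
    partialDeriv i (fun y => f y ^ q) x = q * f x ^ (q - 1) * partialDeriv i f x := by
  simp [partialDeriv, (hf.hasFDerivAt.rpow_const (p := q) (Or.inl hx)).fderiv]

theorem contDiffAt_partialDeriv (hf : ContDiffAt ℝ 2 f x) (i : Fin n) :
    ContDiffAt ℝ 1 (partialDeriv i f) x :=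
  (hf.fderiv_right (m := 1) (by norm_num)).clm_apply contDiffAt_const

theorem differentiableAt_partialDeriv (hf : ContDiffAt ℝ 2 f x) (i : Fin n) :
    DifferentiableAt ℝ (partialDeriv i f) x :=
  (contDiffAt_partialDeriv hf i).differentiableAt one_ne_zero

theorem partialDeriv_comm (hf : ContDiffAt ℝ 2 f x) (i j : Fin n) :
    partialDeriv i (partialDeriv j f) x = partialDeriv j (partialDeriv i f) x := by
  have hd : DifferentiableAt ℝ (fderiv ℝ f) x :=
    (hf.fderiv_right (m := 1) (by norm_num)).differentiableAt one_ne_zero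
  have key : ∀ k l : Fin n, partialDeriv k (partialDeriv l f) x
      = fderiv ℝ (fderiv ℝ f) x (EuclideanSpace.single k 1) (EuclideanSpace.single l 1) := by
    intro k l
    change fderiv ℝ (fun y => fderiv ℝ f y (EuclideanSpace.single l 1)) x _ = _
    rw [fderiv_clm_apply hd (differentiableAt_const _)]
    simp
  rw [key, key]
  exact hf.isSymmSndFDerivAt (by simp) _ _

end PartialDeriv

section Divergence

variable {n : ℕ} {Y Z : Fin n → EuclideanSpace ℝ (Fin n) → ℝ}
  {f w z : EuclideanSpace ℝ (Fin n) → ℝ} {x : EuclideanSpace ℝ (Fin n)}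

theorem divergence_add (hY : ∀ i, DifferentiableAt ℝ (Y i) x)
    (hZ : ∀ i, DifferentiableAt ℝ (Z i) x) :
    divergence (fun i y => Y i y + Z i y) x = divergence Y x + divergence Z x := by
  simp only [divergence, partialDeriv_add (hY _) (hZ _), Finset.sum_add_distrib]

theorem divergence_mul (hf : DifferentiableAt ℝ f x) (hY : ∀ i, DifferentiableAt ℝ (Y i) x) :
    divergence (fun i y => f y * Y i y) x
      = ∑ i, partialDeriv i f x * Y i x + f x * divergence Y x := by
  simp only [divergence, partialDeriv_mul hf (hY _), Finset.sum_add_distrib, Finset.mul_sum]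

theorem divergence_const_mul (c : ℝ) (hY : ∀ i, DifferentiableAt ℝ (Y i) x) :
    divergence (fun i y => c * Y i y) x = c * divergence Y x := by
  rw [divergence_mul (differentiableAt_const c) hY]
  simp [partialDeriv]

theorem divergence_coord : divergence (fun i (y : EuclideanSpace ℝ (Fin n)) => y i) x = n := by
  simp [divergence, partialDeriv_coord]

theorem contDiffAt_rellichField (hw : ContDiffAt ℝ 2 w x) (hz : ContDiffAt ℝ 2 z x) (i : Fin n) :
    ContDiffAt ℝ 1 (rellichField w z i) x := by
  have hW := contDiffAt_partialDeriv hw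
  have hZ := contDiffAt_partialDeriv hz
  have hX : ∀ j : Fin n, ContDiffAt ℝ 1 (fun y : EuclideanSpace ℝ (Fin n) => y j) x :=
    fun j => (EuclideanSpace.proj j : EuclideanSpace ℝ (Fin n) →L[ℝ] ℝ).contDiff.contDiffAt
  exact (((ContDiffAt.sum fun j _ => (hX j).mul (hW j)).mul (hZ i)).add
    ((ContDiffAt.sum fun j _ => (hX j).mul (hZ j)).mul (hW i))).sub
    ((ContDiffAt.sum fun j _ => (hW j).mul (hZ j)).mul (hX i))

theorem divergence_rellichField (hw : ContDiffAt ℝ 2 w x) (hz : ContDiffAt ℝ 2 z x) :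
    divergence (rellichField w z) x
      = (2 - n) * ∑ i, partialDeriv i w x * partialDeriv i z x
        + (∑ i, x i * partialDeriv i w x) * lap z x
        + (∑ i, x i * partialDeriv i z x) * lap w x := by
  have hW := differentiableAt_partialDeriv hw
  have hZ := differentiableAt_partialDeriv hz
  have hX : ∀ j : Fin n, DifferentiableAt ℝ (fun y : EuclideanSpace ℝ (Fin n) => y j) x :=
    fun j => differentiableAt_coord j
  have hd : ∀ i, partialDeriv i (rellichField w z i) x
      = (partialDeriv i w x + ∑ j, x j * partialDeriv i (partialDeriv j w) x) * partialDeriv i z x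
        + (∑ j, x j * partialDeriv j w x) * partialDeriv i (partialDeriv i z) x
        + ((partialDeriv i z x + ∑ j, x j * partialDeriv i (partialDeriv j z) x)
            * partialDeriv i w x
          + (∑ j, x j * partialDeriv j z x) * partialDeriv i (partialDeriv i w) x)
        - ((∑ j, (partialDeriv i (partialDeriv j w) x * partialDeriv j z x
            + partialDeriv j w x * partialDeriv i (partialDeriv j z) x)) * x i
          + ∑ j, partialDeriv j w x * partialDeriv j z x) := by
    intro i
    have h1 := fun j => (hX j).fun_mul (hW j)
    have h2 := fun j => (hX j).fun_mul (hZ j)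
    have h3 := fun j => (hW j).fun_mul (hZ j)
    have s1 := DifferentiableAt.fun_sum (u := Finset.univ) fun j _ => h1 j
    have s2 := DifferentiableAt.fun_sum (u := Finset.univ) fun j _ => h2 j
    have s3 := DifferentiableAt.fun_sum (u := Finset.univ) fun j _ => h3 j
    change partialDeriv i (fun y => (∑ j, y j * partialDeriv j w y) * partialDeriv i z y
      + (∑ j, y j * partialDeriv j z y) * partialDeriv i w y
      - (∑ j, partialDeriv j w y * partialDeriv j z y) * y i) x = _
    rw [partialDeriv_sub ((s1.fun_mul (hZ i)).fun_add (s2.fun_mul (hW i))) (s3.fun_mul (hX i)),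
      partialDeriv_add (s1.fun_mul (hZ i)) (s2.fun_mul (hW i)),
      partialDeriv_mul s1 (hZ i), partialDeriv_mul s2 (hW i), partialDeriv_mul s3 (hX i),
      partialDeriv_sum h1, partialDeriv_sum h2, partialDeriv_sum h3]
    simp only [partialDeriv_mul (hX _) (hW _), partialDeriv_mul (hX _) (hZ _),
      partialDeriv_mul (hW _) (hZ _), partialDeriv_coord, Finset.sum_add_distrib]
    simp
  have e1 : ∑ i, (∑ j, x j * partialDeriv i (partialDeriv j w) x) * partialDeriv i z x
      = ∑ i, (∑ j, partialDeriv i (partialDeriv j w) x * partialDeriv j z x) * x i := by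
    simp only [Finset.sum_mul]
    rw [Finset.sum_comm]
    refine Finset.sum_congr rfl fun i _ => Finset.sum_congr rfl fun j _ => ?_
    rw [partialDeriv_comm hw]; ring
  have e2 : ∑ i, (∑ j, x j * partialDeriv i (partialDeriv j z) x) * partialDeriv i w x
      = ∑ i, (∑ j, partialDeriv j w x * partialDeriv i (partialDeriv j z) x) * x i := by
    simp only [Finset.sum_mul]
    rw [Finset.sum_comm]
    refine Finset.sum_congr rfl fun i _ => Finset.sum_congr rfl fun j _ => ?_
    rw [partialDeriv_comm hz]; ring
  have e3 : ∑ i, partialDeriv i z x * partialDeriv i w x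
      = ∑ i, partialDeriv i w x * partialDeriv i z x :=
    Finset.sum_congr rfl fun i _ => mul_comm _ _
  simp only [lap_eq_divergence]
  simp only [divergence, hd, add_mul, Finset.sum_add_distrib, Finset.sum_sub_distrib,
    ← Finset.mul_sum, e1, e2, e3]
  simp only [Finset.sum_const, Finset.card_univ, Fintype.card_fin, nsmul_eq_mul]
  ring

end Divergence

section DivergenceInequality

variable {n : ℕ} {Y : Fin n → EuclideanSpace ℝ (Fin n) → ℝ}

theorem integral_divergence_eq_zero (hY : ∀ i, ContDiff ℝ 1 (Y i))
    (hc : ∀ i, HasCompactSupport (Y i)) : ∫ x, divergence Y x = 0 := by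
  have hint : ∀ i, Integrable (partialDeriv i (Y i)) := fun i =>
    (((hY i).continuous_fderiv one_ne_zero).clm_apply
      continuous_const).integrable_of_hasCompactSupport ((hc i).fderiv_apply (𝕜 := ℝ) _)
  simp only [divergence]
  rw [integral_finsetSum _ fun i _ => hint i]
  refine Finset.sum_eq_zero fun i _ => ?_
  have := integral_mul_fderiv_eq_neg_fderiv_mul_of_integrable
    (μ := (volume : Measure (EuclideanSpace ℝ (Fin n)))) (𝕜 := ℝ)
    (f := fun _ => (1 : ℝ)) (g := Y i) (v := EuclideanSpace.single i 1)
    (by simp) (by simp only [one_mul]; exact hint i)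
    (by simpa using (hY i).continuous.integrable_of_hasCompactSupport (hc i))
    (fun x _ => differentiableAt_const _) (fun x _ => (hY i).differentiable one_ne_zero x)
  simpa [partialDeriv] using this

/-- A smooth radial function which vanishes for `‖x‖ ^ 2 ≥ R ^ 2 - 1 / k` and equals `1` for
`‖x‖ ^ 2 ≤ R ^ 2 - 2 / k`. -/
def radialCutoff (n : ℕ) (R k : ℝ) (x : EuclideanSpace ℝ (Fin n)) : ℝ :=
  Real.smoothTransition (k * (R ^ 2 - ‖x‖ ^ 2) - 1)

theorem contDiff_radialCutoff (R k : ℝ) : ContDiff ℝ 1 (radialCutoff n R k) :=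
  Real.smoothTransition.contDiff.comp
    ((contDiff_const.mul (contDiff_const.sub (contDiff_norm_sq ℝ))).sub contDiff_const)

theorem partialDeriv_radialCutoff (R k : ℝ) (i : Fin n) (x : EuclideanSpace ℝ (Fin n)) :
    partialDeriv i (radialCutoff n R k) x
      = -(2 * k * deriv Real.smoothTransition (k * (R ^ 2 - ‖x‖ ^ 2) - 1)) * x i := by
  have h1 : HasDerivAt Real.smoothTransition
      (deriv Real.smoothTransition (k * (R ^ 2 - ‖x‖ ^ 2) - 1)) (k * (R ^ 2 - ‖x‖ ^ 2) - 1) :=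
    ((Real.smoothTransition.contDiffAt (n := 1)).differentiableAt (by simp)).hasDerivAt
  have h2 := (((hasStrictFDerivAt_norm_sq x).hasFDerivAt.const_sub (R ^ 2)).const_mul k).sub_const
    (1 : ℝ)
  have h3 : HasFDerivAt (radialCutoff n R k) _ x := h1.comp_hasFDerivAt x h2
  rw [partialDeriv, h3.fderiv]
  simp [EuclideanSpace.inner_single_right]
  ring

/-- If a `C¹` vector field points strictly outward along the boundary of a ball, then its
divergence has nonnegative integral over the ball. -/
theorem integral_divergence_nonneg_of_outward {R : ℝ} (hR : 0 < R)
    {U : Set (EuclideanSpace ℝ (Fin n))} (hU : IsOpen U) (hUB : closedBall 0 R ⊆ U)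
    (hY : ∀ i, ContDiffOn ℝ 1 (Y i) U)
    (hout : ∀ x ∈ sphere (0 : EuclideanSpace ℝ (Fin n)) R, 0 < ∑ i, x i * Y i x) :
    0 ≤ ∫ x in ball (0 : EuclideanSpace ℝ (Fin n)) R, divergence Y x := by
  have hYat : ∀ i, ∀ x ∈ U, ContDiffAt ℝ 1 (Y i) x := fun i x hx =>
    (hY i).contDiffAt (hU.mem_nhds hx)
  have hdivc : ContinuousOn (divergence Y) (closedBall 0 R) := by
    refine continuousOn_finsetSum _ fun i _ => ?_
    exact (((hY i).continuousOn_fderiv_of_isOpen hU le_rfl).mono hUB).clm_apply continuousOn_const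
  have hdivi : IntegrableOn (divergence Y) (ball 0 R) :=
    (hdivc.integrableOn_compact (isCompact_closedBall _ _)).mono_set ball_subset_closedBall
  have hflux : ContinuousOn (fun x : EuclideanSpace ℝ (Fin n) => ∑ i, x i * Y i x)
      (closedBall 0 R) := by
    refine continuousOn_finsetSum _ fun i _ => ?_
    exact (EuclideanSpace.proj i : EuclideanSpace ℝ (Fin n) →L[ℝ] ℝ).continuous.continuousOn.mul
      ((hY i).continuousOn.mono hUB)
  obtain ⟨s, hsR, hs⟩ : ∃ s < R ^ 2, ∀ x ∈ closedBall (0 : EuclideanSpace ℝ (Fin n)) R,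
      s < ‖x‖ ^ 2 → 0 ≤ ∑ i, x i * Y i x := by
    set K := closedBall (0 : EuclideanSpace ℝ (Fin n)) R ∩
      (fun x : EuclideanSpace ℝ (Fin n) => ∑ i, x i * Y i x) ⁻¹' Iic 0 with hK
    have hKc : IsCompact K := (isCompact_closedBall _ _).of_isClosed_subset
      (hflux.preimage_isClosed_of_isClosed isClosed_closedBall isClosed_Iic) inter_subset_left
    rcases K.eq_empty_or_nonempty with hKe | hKn
    · refine ⟨0, by positivity, fun x hx _ => ?_⟩
      by_contra hneg
      have : x ∈ K := ⟨hx, (not_le.1 hneg).le⟩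
      simp [hKe] at this
    · obtain ⟨x₀, hx₀, hmax⟩ := hKc.exists_isMaxOn hKn
        (continuous_norm.pow 2 : Continuous fun x : EuclideanSpace ℝ (Fin n) =>
          ‖x‖ ^ 2).continuousOn
      refine ⟨‖x₀‖ ^ 2, ?_, fun x hx hlt => ?_⟩
      · have hle : ‖x₀‖ ≤ R := by simpa using hx₀.1
        have hne : ‖x₀‖ ≠ R := fun h =>
          absurd (hout x₀ (by simpa using h)) (not_lt.2 hx₀.2)
        have := lt_of_le_of_ne hle hne
        have := norm_nonneg x₀
        nlinarith
      · by_contra hneg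
        exact absurd (hmax (show x ∈ K from ⟨hx, (not_le.1 hneg).le⟩)) (not_le.2 hlt)
  have hcut : ∀ k : ℝ, 2 / (R ^ 2 - s) < k → 0 < k →
      0 ≤ ∫ x in ball (0 : EuclideanSpace ℝ (Fin n)) R, radialCutoff n R k x * divergence Y x := by
    intro k hk hk0
    have hsk : s < R ^ 2 - 2 / k := by
      rw [div_lt_iff₀ (by linarith)] at hk
      have : 2 / k < R ^ 2 - s := by rw [div_lt_iff₀ hk0]; linarith
      linarith
    have hzero : ∀ x : EuclideanSpace ℝ (Fin n), R ^ 2 - 1 / k ≤ ‖x‖ ^ 2 →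
        radialCutoff n R k x = 0 := by
      intro x hx
      refine Real.smoothTransition.zero_of_nonpos ?_
      have : k * (R ^ 2 - ‖x‖ ^ 2) ≤ k * (1 / k) := by gcongr; linarith
      rw [mul_one_div_cancel hk0.ne'] at this
      linarith
    have hsq : ∀ x : EuclideanSpace ℝ (Fin n), x ∉ ball 0 R → R ^ 2 ≤ ‖x‖ ^ 2 := by
      intro x hx
      have : R ≤ ‖x‖ := by simpa using hx
      gcongr
    have hev : ∀ x : EuclideanSpace ℝ (Fin n), x ∉ ball 0 R → radialCutoff n R k =ᶠ[𝓝 x] 0 := by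
      intro x hx
      have hlt : R ^ 2 - 1 / k < ‖x‖ ^ 2 := by
        have := hsq x hx
        have : 0 < 1 / k := by positivity
        linarith
      filter_upwards [(continuous_norm.pow 2).continuousAt.eventually (lt_mem_nhds hlt)] with y hy
      exact hzero y hy.le
    have hev' : ∀ i, ∀ x : EuclideanSpace ℝ (Fin n), x ∉ ball 0 R →
        (fun y => radialCutoff n R k y * Y i y) =ᶠ[𝓝 x] fun _ => 0 := by
      intro i x hx
      filter_upwards [hev x hx] with y hy
      simp [hy]
    have hsmooth : ∀ i, ContDiff ℝ 1 fun x => radialCutoff n R k x * Y i x := by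
      intro i
      refine contDiff_iff_contDiffAt.2 fun x => ?_
      by_cases hx : x ∈ ball (0 : EuclideanSpace ℝ (Fin n)) R
      · exact (contDiff_radialCutoff R k).contDiffAt.mul
          (hYat i x (hUB (ball_subset_closedBall hx)))
      · exact contDiffAt_const.congr_of_eventuallyEq (hev' i x hx)
    have hcs : ∀ i, HasCompactSupport fun x => radialCutoff n R k x * Y i x := fun i =>
      HasCompactSupport.intro (isCompact_closedBall (0 : EuclideanSpace ℝ (Fin n)) R)
        fun x hx => (hev' i x fun h => hx (ball_subset_closedBall h)).self_of_nhds
    have hint0 := integral_divergence_eq_zero hsmooth hcs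
    have hout0 : ∀ x : EuclideanSpace ℝ (Fin n), x ∉ ball 0 R →
        divergence (fun i x => radialCutoff n R k x * Y i x) x = 0 := by
      intro x hx
      refine Finset.sum_eq_zero fun i _ => ?_
      rw [partialDeriv, (hev' i x hx).fderiv_eq]
      simp
    rw [← setIntegral_eq_integral_of_forall_compl_eq_zero hout0] at hint0
    rw [← hint0]
    refine setIntegral_mono_on ?_ ?_ measurableSet_ball fun x hx => ?_
    · refine (Continuous.continuousOn ?_).integrableOn_compact
        (isCompact_closedBall (0 : EuclideanSpace ℝ (Fin n)) R) |>.mono_set ball_subset_closedBall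
      exact continuous_finsetSum _ fun i _ =>
        ((hsmooth i).continuous_fderiv one_ne_zero).clm_apply continuous_const
    · exact (((contDiff_radialCutoff R k).continuous.continuousOn.mul
        hdivc).integrableOn_compact (isCompact_closedBall _ _)).mono_set ball_subset_closedBall
    · have hxU : x ∈ U := hUB (ball_subset_closedBall hx)
      rw [divergence_mul ((contDiff_radialCutoff R k).differentiable one_ne_zero x)
        fun i => (hYat i x hxU).differentiableAt one_ne_zero]
      simp only [partialDeriv_radialCutoff, mul_assoc, ← Finset.mul_sum]
      have hd : 0 ≤ deriv Real.smoothTransition (k * (R ^ 2 - ‖x‖ ^ 2) - 1) :=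
        Real.smoothTransition.monotone.deriv_nonneg
      suffices 0 ≤ deriv Real.smoothTransition (k * (R ^ 2 - ‖x‖ ^ 2) - 1)
          * ∑ i, x i * Y i x by nlinarith
      by_cases hsx : s < ‖x‖ ^ 2
      · exact mul_nonneg hd (hs x (ball_subset_closedBall hx) hsx)
      · have hone : 1 < k * (R ^ 2 - ‖x‖ ^ 2) - 1 := by
          have h2 : 2 / k < R ^ 2 - ‖x‖ ^ 2 := by linarith
          rw [div_lt_iff₀ hk0] at h2
          linarith
        have : Real.smoothTransition =ᶠ[𝓝 (k * (R ^ 2 - ‖x‖ ^ 2) - 1)] fun _ => 1 := by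
          filter_upwards [lt_mem_nhds hone] with t ht
          exact Real.smoothTransition.one_of_one_le ht.le
        simp [this.deriv_eq]
  have hlim : Tendsto (fun k : ℝ => ∫ x in ball (0 : EuclideanSpace ℝ (Fin n)) R,
      radialCutoff n R k x * divergence Y x) atTop
      (𝓝 (∫ x in ball (0 : EuclideanSpace ℝ (Fin n)) R, divergence Y x)) := by
    refine tendsto_integral_filter_of_dominated_convergence (fun x => ‖divergence Y x‖)
      (Eventually.of_forall fun k =>
        (contDiff_radialCutoff R k).continuous.aestronglyMeasurable.mul hdivi.1)
      (Eventually.of_forall fun k => Eventually.of_forall fun x => ?_) hdivi.norm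
      ((ae_restrict_mem measurableSet_ball).mono fun x hx => ?_)
    · rw [norm_mul, radialCutoff, Real.norm_of_nonneg (Real.smoothTransition.nonneg _)]
      exact mul_le_of_le_one_left (norm_nonneg _) (Real.smoothTransition.le_one _)
    · refine tendsto_const_nhds.congr' ?_
      have hx' : ‖x‖ < R := by simpa using hx
      have hpos : 0 < R ^ 2 - ‖x‖ ^ 2 := by nlinarith [norm_nonneg x]
      filter_upwards [eventually_ge_atTop (2 / (R ^ 2 - ‖x‖ ^ 2))] with k hk
      rw [div_le_iff₀ hpos] at hk
      rw [radialCutoff, Real.smoothTransition.one_of_one_le (by linarith), one_mul]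
  refine ge_of_tendsto hlim ?_
  filter_upwards [eventually_gt_atTop (2 / (R ^ 2 - s)), eventually_gt_atTop 0] with k h1 h2
  exact hcut k h1 h2

end DivergenceInequality

/-- At a boundary point where a function that is nonnegative in the ball vanishes, its gradient
is a nonpositive multiple of the position vector. -/
theorem exists_nonpos_partialDeriv_eq_mul {n : ℕ} {R : ℝ} (hR : 0 < R)
    {f : EuclideanSpace ℝ (Fin n) → ℝ} {x : EuclideanSpace ℝ (Fin n)}
    (hx : x ∈ sphere (0 : EuclideanSpace ℝ (Fin n)) R) (hf : DifferentiableAt ℝ f x)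
    (hpos : ∀ y ∈ ball (0 : EuclideanSpace ℝ (Fin n)) R, 0 < f y) (hzero : f x = 0) :
    ∃ b ≤ 0, ∀ i, partialDeriv i f x = b * x i := by
  have hxR : ‖x‖ = R := by simpa using hx
  have hinward : ∀ e : EuclideanSpace ℝ (Fin n), inner ℝ x e < 0 → 0 ≤ fderiv ℝ f x e := by
    intro e he
    have hl : HasLineDerivAt ℝ f (fderiv ℝ f x e) x e := hf.hasFDerivAt.hasLineDerivAt e
    have hl : HasDerivAt (fun t : ℝ => f (x + t • e)) (fderiv ℝ f x e) 0 := hl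
    have ht : Tendsto (slope (fun t : ℝ => f (x + t • e)) 0) (𝓝[>] 0) (𝓝 (fderiv ℝ f x e)) :=
      hl.tendsto_slope.mono_left (nhdsWithin_mono _ fun t ht => ne_of_gt ht)
    refine ge_of_tendsto ht ?_
    have hsmall : ∀ᶠ t : ℝ in 𝓝 0, 2 * inner ℝ x e + t * ‖e‖ ^ 2 < 0 := by
      have hc : Continuous fun t : ℝ => 2 * inner ℝ x e + t * ‖e‖ ^ 2 := by fun_prop
      exact hc.continuousAt.eventually (gt_mem_nhds (by simpa only [zero_mul, add_zero] using by linarith))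
    filter_upwards [self_mem_nhdsWithin, hsmall.filter_mono nhdsWithin_le_nhds] with t ht0 hts
    have ht0 : 0 < t := ht0
    have hmem : x + t • e ∈ ball (0 : EuclideanSpace ℝ (Fin n)) R := by
      have hsq : ‖x + t • e‖ ^ 2 < R ^ 2 := by
        rw [norm_add_sq_real, inner_smul_right, norm_smul, mul_pow, hxR, Real.norm_eq_abs, sq_abs]
        nlinarith
      simpa using lt_of_pow_lt_pow_left₀ 2 hR.le hsq
    have := hpos _ hmem
    simp only [slope_def_field, zero_smul, add_zero, hzero, sub_zero]
    positivity
  set g : EuclideanSpace ℝ (Fin n) := WithLp.toLp 2 fun i => partialDeriv i f x with hg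
  have hgi : ∀ e, fderiv ℝ f x e = inner ℝ g e := by
    intro e
    rw [fderiv_apply_eq_sum]
    simp [PiLp.inner_apply, hg]
  set b := inner ℝ g x / R ^ 2 with hb
  have hgx : inner ℝ g x = b * R ^ 2 := by rw [hb]; field_simp
  have hxx : inner ℝ x x = R ^ 2 := by rw [real_inner_self_eq_norm_sq, hxR]
  have hb0 : b ≤ 0 := by
    have := hinward (-x) (by rw [inner_neg_right, hxx]; nlinarith)
    rw [hgi, inner_neg_right, hgx] at this
    have : 0 < R ^ 2 := by positivity
    nlinarith
  refine ⟨b, hb0, ?_⟩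
  have hxg : inner ℝ x g = b * R ^ 2 := by rw [real_inner_comm, hgx]
  have hle : ∀ ε > 0, ‖g - b • x‖ ^ 2 ≤ 0 + ε := by
    intro ε hε
    have hδ : 0 < ε / (1 + -b * R ^ 2) := by
      have : 0 ≤ -b * R ^ 2 := by nlinarith [sq_nonneg R]
      positivity
    set δ := ε / (1 + -b * R ^ 2) with hδd
    have h1 := hinward (-(g - b • x) - δ • x) (by
      rw [inner_sub_right, inner_neg_right, inner_sub_right, inner_smul_right, inner_smul_right,
        hxg, hxx]
      have : 0 < δ * R ^ 2 := by positivity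
      linarith)
    have h2 : ‖g - b • x‖ ^ 2 = inner ℝ g (g - b • x) := by
      rw [← real_inner_self_eq_norm_sq, inner_sub_left (x := g), inner_smul_left,
        inner_sub_right x, inner_smul_right, hxg, hxx]
      simp
    rw [hgi, inner_sub_right, inner_neg_right, ← h2, inner_smul_right, hgx] at h1
    have h3 : δ * (1 + -b * R ^ 2) = ε := by
      have : 0 ≤ -b * R ^ 2 := by nlinarith [sq_nonneg R]
      exact div_mul_cancel₀ _ (by linarith)
    linarith
  have h0 : g - b • x = 0 := by
    have := le_of_forall_pos_le_add hle
    have h' : ‖g - b • x‖ ^ 2 = 0 := le_antisymm this (sq_nonneg _)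
    simpa using h'
  intro i
  have := congrArg (fun y : EuclideanSpace ℝ (Fin n) => y i) h0
  simp [hg] at this
  linarith

/-- **Rellich-Pohozaev inequality** for solutions of the Dirichlet problem of the system
`-Δu = v^p - u^p`, `-Δv = u^p` on the ball of radius `R`. -/
theorem pohozaev_inequality (n : ℕ) (hn : 3 ≤ n) (p : ℝ) (hp : 1 < p)
    (R : ℝ) (hR : 0 < R)
    (u v : EuclideanSpace ℝ (Fin n) → ℝ) (U : Set (EuclideanSpace ℝ (Fin n)))
    (hU : IsOpen U) (hUB : closedBall (0 : EuclideanSpace ℝ (Fin n)) R ⊆ U)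
    (hu : ContDiffOn ℝ 2 u U) (hv : ContDiffOn ℝ 2 v U)
    (hequ : ∀ x ∈ ball (0 : EuclideanSpace ℝ (Fin n)) R, - lap u x = v x ^ p - u x ^ p)
    (heqv : ∀ x ∈ ball (0 : EuclideanSpace ℝ (Fin n)) R, - lap v x = u x ^ p)
    (hupos : ∀ x ∈ ball (0 : EuclideanSpace ℝ (Fin n)) R, 0 < u x)
    (hvpos : ∀ x ∈ ball (0 : EuclideanSpace ℝ (Fin n)) R, 0 < v x)
    (hub : ∀ x ∈ sphere (0 : EuclideanSpace ℝ (Fin n)) R, u x = 0)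
    (hvb : ∀ x ∈ sphere (0 : EuclideanSpace ℝ (Fin n)) R, v x = 0) :
    0 < ∫ x in ball (0 : EuclideanSpace ℝ (Fin n)) R,
      ((n:ℝ) / (p + 1) - ((n:ℝ) - 2) / 2) * (u x ^ (p + 1) + v x ^ (p + 1)) := by
  have hcont : ∀ {f : EuclideanSpace ℝ (Fin n) → ℝ}, ContDiffOn ℝ 2 f U → ∀ x ∈ U,
      ContDiffAt ℝ 2 f x := fun hf x hx => hf.contDiffAt (hU.mem_nhds hx)
  set c : ℝ := ((n : ℝ) - 2) / 2 with hc
  have hp1 : 0 < p + 1 := by linarith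
  -- A Rellich-type field whose divergence is the integrand, up to a perturbation of size `l`.
  have key : ∀ l : ℝ, 0 < l → 0 ≤ ∫ x in ball (0 : EuclideanSpace ℝ (Fin n)) R,
      (((n : ℝ) / (p + 1) - c) * (u x ^ (p + 1) + v x ^ (p + 1)) - l * u x ^ p
        + l ^ 2 * (n / R ^ 2)) := by
    intro l hl
    set f₁ : EuclideanSpace ℝ (Fin n) → ℝ := fun y =>
      1 / (p + 1) * (u y ^ (p + 1) + v y ^ (p + 1)) + l ^ 2 / R ^ 2 with hf₁
    set f₂ : EuclideanSpace ℝ (Fin n) → ℝ := fun y => c * (u y + v y) + l with hf₂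
    set f₃ : EuclideanSpace ℝ (Fin n) → ℝ := fun y => c * v y with hf₃
    set Y : Fin n → EuclideanSpace ℝ (Fin n) → ℝ := fun i y =>
      rellichField u v i y + 1 / 2 * rellichField v v i y + f₁ y * y i
        + f₂ y * partialDeriv i v y + f₃ y * partialDeriv i u y with hY
    have hX : ∀ (j : Fin n) (x : EuclideanSpace ℝ (Fin n)),
        ContDiffAt ℝ 1 (fun y : EuclideanSpace ℝ (Fin n) => y j) x :=
      fun j x => (EuclideanSpace.proj j : EuclideanSpace ℝ (Fin n) →L[ℝ] ℝ).contDiff.contDiffAt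
    have hpow : ∀ {f : EuclideanSpace ℝ (Fin n) → ℝ}, ContDiffOn ℝ 2 f U → ∀ x ∈ U,
        ContDiffAt ℝ 1 (fun y => f y ^ (p + 1)) x := fun hf x hx =>
      ((hcont hf x hx).of_le (by norm_num)).rpow_const_of_le (m := 1) (by norm_num; linarith)
    have h₁ : ∀ x ∈ U, ContDiffAt ℝ 1 f₁ x := fun x hx =>
      (contDiffAt_const.mul ((hpow hu x hx).add (hpow hv x hx))).add contDiffAt_const
    have h₂ : ∀ x ∈ U, ContDiffAt ℝ 1 f₂ x := fun x hx =>
      (contDiffAt_const.mul (((hcont hu x hx).add (hcont hv x hx)).of_le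
        (by norm_num))).add contDiffAt_const
    have h₃ : ∀ x ∈ U, ContDiffAt ℝ 1 f₃ x := fun x hx =>
      contDiffAt_const.mul ((hcont hv x hx).of_le (by norm_num))
    have hYs : ∀ i, ContDiffOn ℝ 1 (Y i) U := fun i x hx =>
      (((((contDiffAt_rellichField (hcont hu x hx) (hcont hv x hx) i).add
        (contDiffAt_const.mul (contDiffAt_rellichField (hcont hv x hx) (hcont hv x hx) i))).add
        ((h₁ x hx).mul (hX i x))).add
        ((h₂ x hx).mul (contDiffAt_partialDeriv (hcont hv x hx) i))).add
        ((h₃ x hx).mul (contDiffAt_partialDeriv (hcont hu x hx) i))).contDiffWithinAt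
    have hout : ∀ x ∈ sphere (0 : EuclideanSpace ℝ (Fin n)) R, 0 < ∑ i, x i * Y i x := by
      intro x hx
      have hxU : x ∈ U := hUB (sphere_subset_closedBall hx)
      obtain ⟨a, ha0, ha⟩ := exists_nonpos_partialDeriv_eq_mul hR hx
        ((hcont hu x hxU).differentiableAt two_ne_zero) hupos (hub x hx)
      obtain ⟨b, hb0, hb⟩ := exists_nonpos_partialDeriv_eq_mul hR hx
        ((hcont hv x hxU).differentiableAt two_ne_zero) hvpos (hvb x hx)
      have hxx : ∑ i, x i * x i = R ^ 2 := by
        have : ‖x‖ = R := by simpa using hx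
        rw [← this, EuclideanSpace.real_norm_sq_eq]
        exact Finset.sum_congr rfl fun i _ => (sq _).symm
      have s₁ : ∀ t : ℝ, ∑ i, x i * (t * x i) = t * R ^ 2 := fun t => by
        rw [← hxx, Finset.mul_sum]; exact Finset.sum_congr rfl fun i _ => by ring
      have s₂ : ∀ t r : ℝ, ∑ i, t * x i * (r * x i) = t * r * R ^ 2 := fun t r => by
        rw [← hxx, Finset.mul_sum]; exact Finset.sum_congr rfl fun i _ => by ring
      have hYx : ∀ i, x i * Y i x
          = (a * b * R ^ 2 + b ^ 2 * R ^ 2 / 2 + l ^ 2 / R ^ 2 + l * b) * (x i * x i) := by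
        intro i
        simp only [hY, rellichField, hf₁, hf₂, hf₃, ha, hb, s₁, s₂, hub x hx, hvb x hx,
          Real.zero_rpow hp1.ne']
        ring
      have hval : ∑ i, x i * Y i x
          = a * b * R ^ 4 + (b * R ^ 2 + l) ^ 2 / 2 + l ^ 2 / 2 := by
        rw [Finset.sum_congr rfl fun i _ => hYx i, ← Finset.mul_sum, hxx]
        field_simp
        ring
      rw [hval]
      have := mul_nonneg_of_nonpos_of_nonpos ha0 hb0
      positivity
    have hdiv : ∀ x ∈ ball (0 : EuclideanSpace ℝ (Fin n)) R, divergence Y x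
        = ((n : ℝ) / (p + 1) - c) * (u x ^ (p + 1) + v x ^ (p + 1)) - l * u x ^ p
          + l ^ 2 * (n / R ^ 2) := by
      intro x hx
      have hxU : x ∈ U := hUB (ball_subset_closedBall hx)
      have hux := hcont hu x hxU
      have hvx := hcont hv x hxU
      have du := hux.differentiableAt two_ne_zero
      have dv := hvx.differentiableAt two_ne_zero
      have d₁ := (h₁ x hxU).differentiableAt one_ne_zero
      have d₂ := (h₂ x hxU).differentiableAt one_ne_zero
      have d₃ := (h₃ x hxU).differentiableAt one_ne_zero
      have dX := fun i => differentiableAt_coord (x := x) (n := n) i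
      have dU := differentiableAt_partialDeriv hux
      have dV := differentiableAt_partialDeriv hvx
      have dP := fun i => (contDiffAt_rellichField hux hvx i).differentiableAt one_ne_zero
      have dQ := fun i => (contDiffAt_rellichField hvx hvx i).differentiableAt one_ne_zero
      have dQ' := fun i => (dQ i).const_mul (1 / 2 : ℝ)
      have e₁ := fun i => d₁.fun_mul (dX i)
      have e₂ := fun i => d₂.fun_mul (dV i)
      have e₃ := fun i => d₃.fun_mul (dU i)
      have g₁ : ∀ i, partialDeriv i f₁ x
          = u x ^ p * partialDeriv i u x + v x ^ p * partialDeriv i v x := by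
        intro i
        have m := (hpow hu x hxU).differentiableAt one_ne_zero
        have k := (hpow hv x hxU).differentiableAt one_ne_zero
        rw [hf₁, partialDeriv_add ((m.fun_add k).const_mul _) (differentiableAt_const _),
          partialDeriv_mul (differentiableAt_const _) (m.fun_add k), partialDeriv_add m k,
          partialDeriv_rpow du (hupos x hx).ne', partialDeriv_rpow dv (hvpos x hx).ne']
        simp only [partialDeriv, fderiv_fun_const, add_sub_cancel_right]
        simp
        field_simp
      have g₂ : ∀ i, partialDeriv i f₂ x = c * (partialDeriv i u x + partialDeriv i v x) := by
        intro i
        rw [hf₂, partialDeriv_add ((du.fun_add dv).const_mul _) (differentiableAt_const _),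
          partialDeriv_mul (differentiableAt_const _) (du.fun_add dv), partialDeriv_add du dv]
        simp [partialDeriv]
      have g₃ : ∀ i, partialDeriv i f₃ x = c * partialDeriv i v x := by
        intro i
        rw [hf₃, partialDeriv_mul (differentiableAt_const _) dv]
        simp [partialDeriv]
      have hlv : lap v x = -u x ^ p := by linarith [heqv x hx]
      have hlu : lap u x = u x ^ p - v x ^ p := by linarith [hequ x hx]
      have hup : u x ^ (p + 1) = u x ^ p * u x := Real.rpow_add_one (hupos x hx).ne' p
      have hvp : v x ^ (p + 1) = v x ^ p * v x := Real.rpow_add_one (hvpos x hx).ne' p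
      rw [hY, divergence_add (fun i => (((dP i).fun_add (dQ' i)).fun_add (e₁ i)).fun_add (e₂ i)) e₃,
        divergence_add (fun i => ((dP i).fun_add (dQ' i)).fun_add (e₁ i)) e₂,
        divergence_add (fun i => (dP i).fun_add (dQ' i)) e₁, divergence_add dP dQ',
        divergence_const_mul _ dQ, divergence_mul d₁ dX, divergence_mul d₂ dV,
        divergence_mul d₃ dU, divergence_rellichField hux hvx, divergence_rellichField hvx hvx,
        divergence_coord, ← lap_eq_divergence, ← lap_eq_divergence, hlu, hlv]
      have t₁ : ∑ i, partialDeriv i f₁ x * x i = u x ^ p * ∑ i, x i * partialDeriv i u x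
          + v x ^ p * ∑ i, x i * partialDeriv i v x := by
        rw [Finset.mul_sum, Finset.mul_sum, ← Finset.sum_add_distrib]
        exact Finset.sum_congr rfl fun i _ => by rw [g₁]; ring
      have t₂ : ∑ i, partialDeriv i f₂ x * partialDeriv i v x
          = c * (∑ i, partialDeriv i u x * partialDeriv i v x
            + ∑ i, partialDeriv i v x * partialDeriv i v x) := by
        rw [← Finset.sum_add_distrib, Finset.mul_sum]
        exact Finset.sum_congr rfl fun i _ => by rw [g₂]; ring
      have t₃ : ∑ i, partialDeriv i f₃ x * partialDeriv i u x
          = c * ∑ i, partialDeriv i u x * partialDeriv i v x := by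
        rw [Finset.mul_sum]
        exact Finset.sum_congr rfl fun i _ => by rw [g₃]; ring
      rw [t₁, t₂, t₃]
      simp only [hf₁, hf₂, hf₃, hup, hvp, hc]
      ring
    have := integral_divergence_nonneg_of_outward hR hU hUB hYs hout
    rwa [setIntegral_congr_fun measurableSet_ball hdiv] at this
  have hint : ∀ {f : EuclideanSpace ℝ (Fin n) → ℝ}, ContDiffOn ℝ 2 f U → ∀ q : ℝ, 0 ≤ q →
      IntegrableOn (fun x => f x ^ q) (ball 0 R) := fun hf q hq =>
    (((hf.continuousOn.mono hUB).rpow_const fun _ _ => Or.inr hq).integrableOn_compact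
      (isCompact_closedBall _ _)).mono_set ball_subset_closedBall
  have hvol : 0 < volume (ball (0 : EuclideanSpace ℝ (Fin n)) R) := measure_ball_pos _ _ hR
  have iA := hint hu p (by linarith)
  have iI : IntegrableOn (fun x => ((n : ℝ) / (p + 1) - c) * (u x ^ (p + 1) + v x ^ (p + 1)))
      (ball 0 R) := ((hint hu (p + 1) hp1.le).add (hint hv (p + 1) hp1.le)).const_mul _
  have hA : 0 < ∫ x in ball (0 : EuclideanSpace ℝ (Fin n)) R, u x ^ p := by
    rw [setIntegral_pos_iff_support_of_nonneg_ae
      ((ae_restrict_mem measurableSet_ball).mono fun x hx => (Real.rpow_pos_of_pos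
        (hupos x hx) p).le) iA]
    have hsub : ball 0 R ⊆ Function.support fun x => u x ^ p := fun x hx =>
      (Real.rpow_pos_of_pos (hupos x hx) p).ne'
    rwa [inter_eq_right.2 hsub]
  have hBpos : 0 < ((n : ℝ) / R ^ 2) * (volume (ball (0 : EuclideanSpace ℝ (Fin n)) R)).toReal := by
    have : 0 < (volume (ball (0 : EuclideanSpace ℝ (Fin n)) R)).toReal :=
      ENNReal.toReal_pos hvol.ne' measure_ball_lt_top.ne
    have : (0 : ℝ) < n := by exact_mod_cast (by omega : 0 < n)
    positivity
  set A := ∫ x in ball (0 : EuclideanSpace ℝ (Fin n)) R, u x ^ p with hAdef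
  set B := ((n : ℝ) / R ^ 2) * (volume (ball (0 : EuclideanSpace ℝ (Fin n)) R)).toReal with hBdef
  have hquad : ∀ l : ℝ, 0 < l → 0 ≤ (∫ x in ball (0 : EuclideanSpace ℝ (Fin n)) R,
      ((n : ℝ) / (p + 1) - c) * (u x ^ (p + 1) + v x ^ (p + 1))) - l * A + l ^ 2 * B := by
    intro l hl
    have h := key l hl
    have iC : IntegrableOn (fun _ : EuclideanSpace ℝ (Fin n) => l ^ 2 * ((n : ℝ) / R ^ 2))
      (ball 0 R) := integrableOn_const measure_ball_lt_top.ne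
    have iD : IntegrableOn (fun x => ((n : ℝ) / (p + 1) - c) * (u x ^ (p + 1) + v x ^ (p + 1))
      - l * u x ^ p) (ball 0 R) := iI.sub (iA.const_mul l)
    rw [integral_add iD iC, integral_sub iI (iA.const_mul l),
      integral_const_mul l, setIntegral_const, smul_eq_mul, Measure.real] at h
    rw [hBdef]
    linarith
  have h := hquad (A / (2 * B)) (by positivity)
  have hq : A / (2 * B) * A - (A / (2 * B)) ^ 2 * B = A ^ 2 / (4 * B) := by
    field_simp
    ring
  have : 0 < A ^ 2 / (4 * B) := by positivity
  linarith
end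
end

section
/- Let n ≥ 3 and let p, q be real numbers with p ≠ q, p ≥ (n+2)/(n−2) and q ≥ (n+2)/(n−2). Then the system −Δu = v^p + v^q − u^p, −Δv = u^p in ℝ^n, with u > 0 and v > 0 in ℝ^n, admits a twice continuously differentiable radially symmetric solution, i.e. there exist positive C² functions u, v : ℝ^n → ℝ, each depending on x only through |x|, satisfying the system on all of ℝ^n. -/
noncomputable section
open Set Metric
open scoped BigOperators

open Filter Topology

section RadialAverage

variable {E : Type*} [NormedAddCommGroup E] [NormedSpace ℝ E]

/-- The mean of `g` over `[0, r]` with the radial weight `s ^ N`, rescaled to `[0, 1]`: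
`radialAvg N g r = ∫₀¹ t ^ N g(r t) dt`. -/
def radialAvg (N : ℕ) (g : ℝ → E) (r : ℝ) : E := ∫ t in (0 : ℝ)..1, t ^ N • g (r * t)

lemma continuous_radialAvg (N : ℕ) {g : ℝ → E} (hg : Continuous g) :
    Continuous (radialAvg N g) := by
  unfold radialAvg
  apply intervalIntegral.continuous_parametric_intervalIntegral_of_continuous'
  simp only [Function.uncurry_def]
  fun_prop

lemma pow_smul_radialAvg (N : ℕ) (g : ℝ → E) (r : ℝ) :
    r ^ (N + 1) • radialAvg N g r = ∫ s in (0 : ℝ)..r, s ^ N • g s := by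
  have h := intervalIntegral.smul_integral_comp_mul_left (a := 0) (b := 1)
    (fun s : ℝ => s ^ N • g s) r
  simp only [mul_zero, mul_one] at h
  rw [← h, pow_succ', mul_smul, radialAvg, ← intervalIntegral.integral_smul]
  congr 2
  funext t
  rw [mul_pow, mul_smul]

lemma norm_radialAvg_le (N : ℕ) {g : ℝ → E} {r B : ℝ}
    (h : ∀ t ∈ Icc (0 : ℝ) 1, ‖g (r * t)‖ ≤ B) : ‖radialAvg N g r‖ ≤ B := by
  have := intervalIntegral.norm_integral_le_of_norm_le_const (a := 0) (b := 1) (C := B)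
    (f := fun t : ℝ => t ^ N • g (r * t)) ?_
  · simpa [radialAvg] using this
  · intro t ht
    rw [uIoc_of_le zero_le_one] at ht
    have h1 := h t ⟨ht.1.le, ht.2⟩
    rw [norm_smul, norm_pow, Real.norm_of_nonneg ht.1.le]
    calc t ^ N * ‖g (r * t)‖ ≤ 1 * B := by
          gcongr
          exact pow_le_one₀ ht.1.le ht.2
      _ = B := one_mul B

lemma radialAvg_sub (N : ℕ) {g h : ℝ → E} (hg : Continuous g) (hh : Continuous h) (r : ℝ) :
    radialAvg N (fun s => g s - h s) r = radialAvg N g r - radialAvg N h r := by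
  unfold radialAvg
  rw [← intervalIntegral.integral_sub]
  · simp only [smul_sub]
  · exact Continuous.intervalIntegrable (by fun_prop) _ _
  · exact Continuous.intervalIntegrable (by fun_prop) _ _

lemma radialAvg_congr (N : ℕ) {g h : ℝ → E} {r : ℝ} (hr : 0 ≤ r)
    (H : ∀ s, 0 ≤ s → g s = h s) : radialAvg N g r = radialAvg N h r := by
  unfold radialAvg
  apply intervalIntegral.integral_congr
  intro t ht
  rw [uIcc_of_le zero_le_one] at ht
  simp only [H _ (mul_nonneg hr ht.1)]

lemma radialAvg_nonneg (N : ℕ) {g : ℝ → ℝ} (hg : ∀ s, 0 ≤ g s) (r : ℝ) :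
    0 ≤ radialAvg N g r :=
  intervalIntegral.integral_nonneg zero_le_one fun _ ht => mul_nonneg (pow_nonneg ht.1 N) (hg _)

lemma radialAvg_pos (N : ℕ) {g : ℝ → ℝ} (hg : Continuous g) {r : ℝ} (hr : 0 < r)
    (hpos : ∀ s, 0 < s → s < r → 0 < g s) : 0 < radialAvg N g r := by
  refine intervalIntegral.intervalIntegral_pos_of_pos_on
    (Continuous.intervalIntegrable (by fun_prop) _ _) (fun t ht => ?_) one_pos
  exact mul_pos (pow_pos ht.1 N)
    (hpos _ (mul_pos hr ht.1) (mul_lt_of_lt_one_right hr ht.2))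

lemma radialAvg_clm {F : Type*} [NormedAddCommGroup F] [NormedSpace ℝ F] [CompleteSpace E]
    [CompleteSpace F] (N : ℕ) (L : E →L[ℝ] F) {g : ℝ → E} (hg : Continuous g) (r : ℝ) :
    L (radialAvg N g r) = radialAvg N (fun s => L (g s)) r := by
  unfold radialAvg
  rw [← L.intervalIntegral_comp_comm]
  · simp only [map_smul]
  · exact Continuous.intervalIntegrable (by fun_prop) _ _

/-- The operator `g ↦ ∫₀ʳ s · radialAvg N g s ds`; up to the sign it inverts the radial
Laplacian in dimension `N + 1`. -/
def radialPotential (N : ℕ) (g : ℝ → E) (r : ℝ) : E := ∫ s in (0 : ℝ)..r, s • radialAvg N g s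

lemma hasDerivAt_radialPotential [CompleteSpace E] (N : ℕ) {g : ℝ → E} (hg : Continuous g)
    (r : ℝ) : HasDerivAt (radialPotential N g) (r • radialAvg N g r) r := by
  have hc := continuous_radialAvg N hg
  have : Continuous fun s : ℝ => s • radialAvg N g s := by fun_prop
  exact (this.integral_hasStrictDerivAt 0 r).hasDerivAt

lemma continuous_radialPotential [CompleteSpace E] (N : ℕ) {g : ℝ → E} (hg : Continuous g) :
    Continuous (radialPotential N g) :=
  continuous_iff_continuousAt.2 fun r => (hasDerivAt_radialPotential N hg r).continuousAt

lemma radialPotential_sub (N : ℕ) {g h : ℝ → E} (hg : Continuous g) (hh : Continuous h) (r : ℝ) :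
    radialPotential N (fun s => g s - h s) r = radialPotential N g r - radialPotential N h r := by
  have h1 := continuous_radialAvg N hg
  have h2 := continuous_radialAvg N hh
  unfold radialPotential
  rw [← intervalIntegral.integral_sub]
  · simp only [radialAvg_sub N hg hh, smul_sub]
  · exact Continuous.intervalIntegrable (by fun_prop) _ _
  · exact Continuous.intervalIntegrable (by fun_prop) _ _

lemma norm_radialPotential_le (N : ℕ) {g : ℝ → E} {lam B r : ℝ} (hlam : 0 < lam) (hB : 0 ≤ B)
    (hr : 0 ≤ r) (h : ∀ s, 0 ≤ s → ‖g s‖ ≤ B * Real.exp (lam * s ^ 2)) :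
    ‖radialPotential N g r‖ ≤ B / (2 * lam) * Real.exp (lam * r ^ 2) := by
  have hd : ∀ s : ℝ, HasDerivAt (fun s => B / (2 * lam) * Real.exp (lam * s ^ 2))
      (s * (B * Real.exp (lam * s ^ 2))) s := by
    intro s
    have h1 : HasDerivAt (fun s : ℝ => lam * s ^ 2) (lam * (2 * s)) s := by
      simpa using (hasDerivAt_pow 2 s).const_mul lam
    refine (h1.exp.const_mul (B / (2 * lam))).congr_deriv ?_
    field_simp
  have hint : IntervalIntegrable (fun s => s * (B * Real.exp (lam * s ^ 2)))
      MeasureTheory.volume 0 r := Continuous.intervalIntegrable (by fun_prop) _ _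
  have h1 := intervalIntegral.norm_integral_le_of_norm_le (f := fun s => s • radialAvg N g s) hr
    (Eventually.of_forall fun s hs => ?_) hint
  · rw [intervalIntegral.integral_eq_sub_of_hasDerivAt (fun s _ => hd s) hint] at h1
    refine h1.trans (sub_le_self _ ?_)
    positivity
  · rw [norm_smul, Real.norm_of_nonneg hs.1.le]
    refine mul_le_mul_of_nonneg_left (norm_radialAvg_le N fun t ht => ?_) hs.1.le
    refine (h _ (mul_nonneg hs.1.le ht.1)).trans ?_
    gcongr
    · exact mul_nonneg hs.1.le ht.1
    · exact mul_le_of_le_one_right hs.1.le ht.2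

lemma hasDerivAt_radialAvg [CompleteSpace E] (N : ℕ) {g : ℝ → E} (hg : Continuous g) {r : ℝ}
    (hr : r ≠ 0) :
    HasDerivAt (radialAvg N g) (r⁻¹ • (g r - ((N : ℝ) + 1) • radialAvg N g r)) r := by
  have hc : Continuous fun s : ℝ => s ^ N • g s := by fun_prop
  have h1 := (hc.integral_hasStrictDerivAt 0 r).hasDerivAt
  have h2 : HasDerivAt (fun s : ℝ => (s ^ (N + 1))⁻¹)
      (-(((N + 1 : ℕ) : ℝ) * r ^ N) / (r ^ (N + 1)) ^ 2) r :=
    (hasDerivAt_pow (N + 1) r).inv (pow_ne_zero _ hr)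
  have h3 := h2.smul h1
  rw [← pow_smul_radialAvg] at h3
  refine (h3.congr_of_eventuallyEq ?_).congr_deriv ?_
  · filter_upwards [isOpen_ne.mem_nhds hr] with s hs
    simp only [Pi.smul_apply', ← pow_smul_radialAvg, smul_smul]
    rw [inv_mul_cancel₀ (pow_ne_zero _ hs), one_smul]
  · simp only [smul_smul, smul_sub]
    rw [sub_eq_add_neg, ← neg_smul]
    congr 2
    · field_simp
      ring
    · push_cast
      field_simp
      ring

/-- Global solvability of the radial initial value problem `-Δw = F(w)`, `w(0) = α`, for a bounded
Lipschitz nonlinearity, with Lipschitz dependence on the initial value. -/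
theorem exists_radial_solution_s12 [CompleteSpace E] (N : ℕ) {F : E → E} {K : NNReal}
    (hF : LipschitzWith K F) {C : ℝ} (hC : ∀ x, ‖F x‖ ≤ C) :
    ∃ w : E → ℝ → E, (∀ α, Continuous (w α)) ∧ (∀ α, w α 0 = α) ∧
      (∀ α r, 0 ≤ r →
        HasDerivAt (w α) (-(r • radialAvg N (fun s => F (w α s)) r)) r) ∧
      ∃ lam : ℝ, 0 ≤ lam ∧ ∀ α β r, 0 ≤ r →
        dist (w α r) (w β r) ≤ 2 * dist α β * Real.exp (lam * r ^ 2) := by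
  have hC0 : 0 ≤ C := (norm_nonneg _).trans (hC 0)
  have hFc : Continuous F := hF.continuous
  set lam : ℝ := K + 1 with hlam_def
  have hlam : 0 < lam := by positivity
  let X := BoundedContinuousFunction ℝ E
  let G : X → ℝ → E := fun W s => F (Real.exp (lam * s ^ 2) • W s)
  have hG : ∀ W, Continuous (G W) := fun W => by
    have := W.continuous
    fun_prop
  have hcont : ∀ (α : E) (W : X), Continuous fun r : ℝ =>
      Real.exp (-(lam * r ^ 2)) • (α - radialPotential N (G W) |r|) := fun α W => by
    have := continuous_radialPotential N (hG W)
    fun_prop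
  have hexp : ∀ r : ℝ, Real.exp (-(lam * r ^ 2)) * Real.exp (lam * r ^ 2) = 1 := fun r => by
    rw [← Real.exp_add]; simp
  have hexp1 : ∀ r : ℝ, Real.exp (-(lam * r ^ 2)) ≤ 1 := fun r => by
    rw [Real.exp_le_one_iff, neg_nonpos]; positivity
  have hbd : ∀ (α : E) (W : X) (r : ℝ),
      ‖Real.exp (-(lam * r ^ 2)) • (α - radialPotential N (G W) |r|)‖ ≤
        ‖α‖ + C / (2 * lam) := fun α W r => by
    have h1 := norm_radialPotential_le N (g := G W) hlam hC0 (abs_nonneg r) fun s _ =>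
      (hC _).trans (le_mul_of_one_le_right hC0 (Real.one_le_exp (by positivity)))
    rw [sq_abs] at h1
    rw [norm_smul, Real.norm_of_nonneg (Real.exp_nonneg _)]
    calc _ ≤ Real.exp (-(lam * r ^ 2)) *
          (‖α‖ + C / (2 * lam) * Real.exp (lam * r ^ 2)) := by
          gcongr
          exact (norm_sub_le _ _).trans (by gcongr)
      _ = Real.exp (-(lam * r ^ 2)) * ‖α‖ +
          C / (2 * lam) * (Real.exp (-(lam * r ^ 2)) * Real.exp (lam * r ^ 2)) := by ring
      _ ≤ _ := by
          rw [hexp, mul_one]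
          gcongr
          exact mul_le_of_le_one_left (norm_nonneg _) (hexp1 r)
  let Φ : E → X → X := fun α W => BoundedContinuousFunction.ofNormedAddCommGroup _
    (hcont α W) _ (hbd α W)
  have hΦ : ∀ α W r, Φ α W r =
      Real.exp (-(lam * r ^ 2)) • (α - radialPotential N (G W) |r|) := fun _ _ _ => rfl
  have hcontr : ∀ α, ContractingWith (1 / 2) (Φ α) := fun α => by
    refine ⟨by
      rw [← NNReal.coe_lt_coe]
      norm_num, LipschitzWith.of_dist_le_mul fun W W' => ?_⟩
    rw [BoundedContinuousFunction.dist_le (by positivity)]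
    intro r
    have h1 := norm_radialPotential_le N (g := fun s => G W' s - G W s) (B := K * dist W W') hlam
      (by positivity) (abs_nonneg r) fun s _ => by
        rw [← dist_eq_norm, dist_comm]
        refine (hF.dist_le_mul _ _).trans ?_
        rw [dist_smul₀, Real.norm_of_nonneg (Real.exp_nonneg _), mul_assoc]
        have := BoundedContinuousFunction.dist_coe_le_dist (f := W) (g := W') s
        rw [mul_comm (Real.exp _)]
        gcongr
    rw [radialPotential_sub N (hG W') (hG W), sq_abs] at h1
    rw [dist_eq_norm, hΦ, hΦ, ← smul_sub, sub_sub_sub_cancel_left, norm_smul,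
      Real.norm_of_nonneg (Real.exp_nonneg _)]
    calc _ ≤ Real.exp (-(lam * r ^ 2)) *
          (K * dist W W' / (2 * lam) * Real.exp (lam * r ^ 2)) := by gcongr
      _ = K * dist W W' / (2 * lam) * (Real.exp (-(lam * r ^ 2)) * Real.exp (lam * r ^ 2)) := by
          ring
      _ = (K / lam) * (dist W W' / 2) := by rw [hexp]; field_simp
      _ ≤ 1 * (dist W W' / 2) := by
          gcongr
          rw [div_le_one hlam]
          linarith
      _ = _ := by push_cast; ring
  let W : E → X := fun α => ContractingWith.fixedPoint (Φ α) (hcontr α)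
  have hW : ∀ α r, W α r = Real.exp (-(lam * r ^ 2)) •
      (α - radialPotential N (G (W α)) |r|) := fun α r => by
    rw [← hΦ]
    exact congrArg (fun f : X => f r) (hcontr α).fixedPoint_isFixedPt.symm
  have hWd : ∀ α β, dist (W α) (W β) ≤ 2 * dist α β := fun α β => by
    refine ((hcontr α).fixedPoint_lipschitz_in_map (hcontr β) (C := dist α β)
      fun V => ?_).trans (le_of_eq ?_)
    · rw [BoundedContinuousFunction.dist_le dist_nonneg]
      intro r
      rw [hΦ, hΦ, dist_smul₀, dist_sub_right, Real.norm_of_nonneg (Real.exp_nonneg _)]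
      exact mul_le_of_le_one_left dist_nonneg (hexp1 r)
    · push_cast; ring
  let w : E → ℝ → E := fun α r => α - radialPotential N (G (W α)) r
  have hwW : ∀ α r, 0 ≤ r → w α r = Real.exp (lam * r ^ 2) • W α r := fun α r hr => by
    rw [hW, smul_smul, mul_comm, hexp, one_smul, abs_of_nonneg hr]
  have hder : ∀ α r, HasDerivAt (w α) (-(r • radialAvg N (G (W α)) r)) r := fun α r =>
    (hasDerivAt_radialPotential N (hG (W α)) r).const_sub α
  refine ⟨w, fun α => continuous_iff_continuousAt.2 fun r => (hder α r).continuousAt,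
    fun α => by simp [w, radialPotential], fun α r hr => ?_, lam, hlam.le, fun α β r hr => ?_⟩
  · rw [radialAvg_congr N (h := G (W α)) hr fun s hs => by rw [hwW α s hs]]
    exact hder α r
  · rw [hwW α r hr, hwW β r hr, dist_smul₀, Real.norm_of_nonneg (Real.exp_nonneg _), mul_comm]
    gcongr
    exact (BoundedContinuousFunction.dist_coe_le_dist r).trans (hWd α β)

end RadialAverage

section RadialLaplacian

variable {X : Type*} [NormedAddCommGroup X] [InnerProductSpace ℝ X]

lemma hasFDerivAt_norm_of_ne_zero {x : X} (hx : x ≠ 0) :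
    HasFDerivAt (fun y : X => ‖y‖) (‖x‖⁻¹ • innerSL ℝ x) x := by
  have h := ((hasStrictFDerivAt_norm_sq x).hasFDerivAt).sqrt
    (pow_ne_zero 2 (norm_ne_zero_iff.2 hx))
  simp only [Real.sqrt_sq (norm_nonneg _)] at h
  refine h.congr_fderiv ?_
  ext y
  simp
  field_simp

lemma radialAvg_zero (N : ℕ) (g : ℝ → ℝ) : ((N : ℝ) + 1) * radialAvg N g 0 = g 0 := by
  have : (N : ℝ) + 1 ≠ 0 := by positivity
  simp [radialAvg]
  field_simp

lemma hasFDerivAt_radial (N : ℕ) {g φ : ℝ → ℝ}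
    (hφ : ∀ r, 0 ≤ r → HasDerivAt φ (-(r * radialAvg N g r)) r) (x : X) :
    HasFDerivAt (fun y : X => φ ‖y‖) (-(radialAvg N g ‖x‖) • innerSL ℝ x) x := by
  rcases eq_or_ne x 0 with rfl | hx
  · have h0 := hφ 0 le_rfl
    rw [zero_mul, neg_zero] at h0
    have h1 := hasDerivAt_iff_isLittleO.1 h0
    rw [hasFDerivAt_iff_isLittleO]
    have h2 : Tendsto (fun y : X => ‖y‖) (𝓝 0) (𝓝 0) := by
      simpa using (continuous_norm (E := X)).tendsto 0
    have h3 := h1.comp_tendsto h2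
    refine Asymptotics.IsLittleO.of_norm_right ?_
    simpa [Function.comp_def] using h3
  · have h := (hφ ‖x‖ (norm_nonneg x)).comp_hasFDerivAt x (hasFDerivAt_norm_of_ne_zero hx)
    refine h.congr_fderiv ?_
    rw [smul_smul]
    congr 1
    have := norm_ne_zero_iff.2 hx
    field_simp

variable (X) in
/-- The real inner product as a continuous bilinear map. -/
def innerCLM : X →L[ℝ] X →L[ℝ] ℝ := innerSL ℝ

lemma innerCLM_apply (x : X) : innerCLM X x = innerSL ℝ x := rfl

/-- The derivative of the field `x ↦ radialAvg N g ‖x‖ • x`. -/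
def radialHessian (N : ℕ) (g : ℝ → ℝ) (x : X) : X →L[ℝ] X :=
  radialAvg N g ‖x‖ • ContinuousLinearMap.id ℝ X +
    (‖x‖⁻¹ ^ 2 * (g ‖x‖ - ((N : ℝ) + 1) * radialAvg N g ‖x‖)) • (innerSL ℝ x).smulRight x

lemma hasFDerivAt_radialField (N : ℕ) {g : ℝ → ℝ} (hg : Continuous g) (x : X) :
    HasFDerivAt (fun y : X => radialAvg N g ‖y‖ • y) (radialHessian N g x) x := by
  rcases eq_or_ne x 0 with rfl | hx
  · rw [hasFDerivAt_iff_isLittleO]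
    have hc : Continuous fun y : X => radialAvg N g ‖y‖ :=
      (continuous_radialAvg N hg).comp continuous_norm
    have h1 : (fun y : X => radialAvg N g ‖y‖ - radialAvg N g ‖(0 : X)‖) =o[𝓝 0]
        fun _ : X => (1 : ℝ) := by
      rw [Asymptotics.isLittleO_one_iff]
      simpa using (hc.tendsto 0).sub_const (radialAvg N g ‖(0 : X)‖)
    have h3 := h1.smul_isBigO (Asymptotics.isBigO_refl (fun y : X => y) (𝓝 0))
    simp only [one_smul] at h3
    simpa [radialHessian, sub_smul] using h3
  · have hr := norm_ne_zero_iff.2 hx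
    have h1 := (hasDerivAt_radialAvg N hg hr).comp_hasFDerivAt x (hasFDerivAt_norm_of_ne_zero hx)
    refine (h1.smul (hasFDerivAt_id x)).congr_fderiv ?_
    ext y
    simp only [radialHessian, Function.comp_apply, smul_eq_mul, id_eq, add_apply, smul_apply,
      ContinuousLinearMap.smulRight_apply, smul_smul, innerSL_apply_apply,
      ContinuousLinearMap.id_apply]
    congr 2
    ring

lemma continuous_radialHessian (N : ℕ) {g : ℝ → ℝ} (hg : Continuous g) :
    Continuous (radialHessian N g : X → X →L[ℝ] X) := by
  have hm := continuous_radialAvg N hg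
  have hS : Continuous fun x : X => (innerSL ℝ x).smulRight x :=
    ((ContinuousLinearMap.smulRightL ℝ X X).continuous.comp
      (innerCLM X).continuous).clm_apply continuous_id
  have hA : Continuous fun x : X => radialAvg N g ‖x‖ • ContinuousLinearMap.id ℝ X :=
    (hm.comp continuous_norm).smul continuous_const
  have hd : Continuous fun x : X => g ‖x‖ - ((N : ℝ) + 1) * radialAvg N g ‖x‖ := by fun_prop
  refine hA.add ?_
  rw [continuous_iff_continuousAt]
  intro x
  rcases eq_or_ne x 0 with rfl | hx
  · have h0 : Tendsto (fun x : X => |g ‖x‖ - ((N : ℝ) + 1) * radialAvg N g ‖x‖|) (𝓝 0) (𝓝 0) := by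
      have := (hd.tendsto 0).abs
      rwa [norm_zero, radialAvg_zero, sub_self, abs_zero] at this
    have : Tendsto (fun x : X => (‖x‖⁻¹ ^ 2 * (g ‖x‖ - ((N : ℝ) + 1) * radialAvg N g ‖x‖)) •
      (innerSL ℝ x).smulRight x) (𝓝 0) (𝓝 0) := by
      refine squeeze_zero_norm (fun y => ?_) h0
      rw [norm_smul, norm_mul, ContinuousLinearMap.norm_smulRight_apply, innerSL_apply_norm,
        Real.norm_eq_abs (g _ - _)]
      rcases eq_or_ne y 0 with rfl | hy
      · simp
      · have := norm_ne_zero_iff.2 hy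
        rw [norm_pow, norm_inv, norm_norm]
        field_simp
        exact le_rfl
    simpa [ContinuousAt] using this
  · have : ContinuousAt (fun x : X => ‖x‖⁻¹) x :=
      continuous_norm.continuousAt.inv₀ (norm_ne_zero_iff.2 hx)
    exact ((this.pow 2).mul hd.continuousAt).smul hS.continuousAt

/-- A radial function whose profile satisfies `φ' = -r · radialAvg N g` is of class `C²`. -/
theorem contDiff_two_radial (N : ℕ) {g φ : ℝ → ℝ} (hg : Continuous g)
    (hφ : ∀ r, 0 ≤ r → HasDerivAt φ (-(r * radialAvg N g r)) r) :
    ContDiff ℝ 2 fun x : X => φ ‖x‖ := by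
  have h1 : ContDiff ℝ 1 fun x : X => radialAvg N g ‖x‖ • x := by
    have h := contDiff_succ_iff_hasFDerivAt (𝕜 := ℝ) (n := 0)
      (f := fun x : X => radialAvg N g ‖x‖ • x)
    simp only [Nat.cast_zero, zero_add] at h
    exact h.2 ⟨_, contDiff_zero.2 (continuous_radialHessian N hg), hasFDerivAt_radialField N hg⟩
  have h := contDiff_succ_iff_hasFDerivAt (𝕜 := ℝ) (n := 1) (f := fun x : X => φ ‖x‖)
  simp only [Nat.cast_one, one_add_one_eq_two] at h
  refine h.2 ⟨fun x => innerCLM X (-(radialAvg N g ‖x‖ • x)),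
    (innerCLM X).contDiff.comp h1.neg, fun x => ?_⟩
  refine (hasFDerivAt_radial N hφ x).congr_fderiv ?_
  simp only [map_neg, map_smul, innerCLM_apply, neg_smul]

theorem neg_lap_radial (N : ℕ) {g φ : ℝ → ℝ} (hg : Continuous g)
    (hφ : ∀ r, 0 ≤ r → HasDerivAt φ (-(r * radialAvg N g r)) r)
    (x : EuclideanSpace ℝ (Fin (N + 1))) :
    -lap (fun y => φ ‖y‖) x = g ‖x‖ := by
  have h1 : ∀ y e : EuclideanSpace ℝ (Fin (N + 1)), fderiv ℝ (fun y => φ ‖y‖) y e =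
      -inner ℝ (radialAvg N g ‖y‖ • y) e := fun y e => by
    rw [(hasFDerivAt_radial N hφ y).fderiv]
    simp [inner_smul_left]
  have h2 : ∀ e, fderiv ℝ (fun y : EuclideanSpace ℝ (Fin (N + 1)) =>
      -inner ℝ (radialAvg N g ‖y‖ • y) e) x e = -inner ℝ (radialHessian N g x e) e := fun e => by
    have h := ((hasFDerivAt_radialField N hg x).inner ℝ (hasFDerivAt_const e x)).neg
    refine (DFunLike.congr_fun h.fderiv e).trans ?_
    simp
  have h3 : ∑ i, x i * x i = ‖x‖ ^ 2 := by
    rw [EuclideanSpace.norm_sq_eq]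
    simp [sq]
  simp only [lap, h1, h2]
  simp only [Finset.sum_neg_distrib, neg_neg, radialHessian, add_apply, smul_apply,
    ContinuousLinearMap.smulRight_apply, innerSL_apply_apply, inner_add_left, inner_smul_left,
    EuclideanSpace.inner_single_right, Finset.sum_add_distrib, ← Finset.mul_sum]
  simp [h3]
  rcases eq_or_ne x 0 with rfl | hx
  · simpa [mul_comm] using radialAvg_zero N g
  · have := norm_ne_zero_iff.2 hx
    field_simp
    ring

end RadialLaplacian

section FirstZero

/-- A radial function leaves the positive half-line strictly at a zero where the source is
positive. -/
lemma eventually_neg_of_zero (N : ℕ) {g φ : ℝ → ℝ} (hg : Continuous g)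
    (hφ : ∀ r, 0 ≤ r → HasDerivAt φ (-(r * radialAvg N g r)) r) {R : ℝ} (hR : 0 ≤ R)
    (hφR : φ R = 0) (havg : 0 ≤ radialAvg N g R) (hgR : 0 < g R) :
    ∀ᶠ r in 𝓝[>] R, φ r < 0 := by
  obtain ⟨ε, hε, hball⟩ := Metric.eventually_nhds_iff.1 (hg.continuousAt.eventually_const_lt hgR)
  have hpos : ∀ r, R < r → r < R + ε → 0 < radialAvg N g r := by
    intro r h1 h2
    have hc : Continuous fun s : ℝ => s ^ N • g s := by fun_prop
    have hadd := intervalIntegral.integral_add_adjacent_intervals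
      (hc.intervalIntegrable (μ := MeasureTheory.volume) 0 R) (hc.intervalIntegrable R r)
    rw [← pow_smul_radialAvg, ← pow_smul_radialAvg] at hadd
    have hint : 0 < ∫ s in R..r, s ^ N • g s := by
      refine intervalIntegral.intervalIntegral_pos_of_pos_on (hc.intervalIntegrable _ _)
        (fun s hs => mul_pos (pow_pos (hR.trans_lt hs.1) N) (hball ?_)) h1
      rw [Real.dist_eq, abs_lt]
      constructor <;> linarith [hs.1, hs.2]
    have h0 : 0 ≤ R ^ (N + 1) • radialAvg N g R := mul_nonneg (pow_nonneg hR _) havg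
    have h3 : 0 < r ^ (N + 1) • radialAvg N g r := by linarith
    exact pos_of_mul_pos_right h3 (pow_nonneg (hR.trans h1.le) _)
  have hanti : StrictAntiOn φ (Ico R (R + ε)) := by
    refine strictAntiOn_of_deriv_neg (convex_Ico _ _)
      (fun r hr => (hφ r (hR.trans hr.1)).continuousAt.continuousWithinAt) fun r hr => ?_
    rw [interior_Ico] at hr
    have hr0 : 0 < r := hR.trans_lt hr.1
    rw [(hφ r hr0.le).deriv, neg_lt_zero]
    exact mul_pos hr0 (hpos r hr.1 hr.2)
  filter_upwards [Ioo_mem_nhdsGT (lt_add_of_pos_right R hε)] with r hr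
  rw [← hφR]
  exact hanti ⟨le_rfl, lt_add_of_pos_right R hε⟩ ⟨hr.1.le, hr.2⟩ hr.1

lemma deriv_nonpos_of_pos_left {φ : ℝ → ℝ} {d R : ℝ} (hR : 0 < R) (hφ : HasDerivAt φ d R)
    (hφR : φ R = 0) (hpos : ∀ s, 0 ≤ s → s < R → 0 < φ s) : d ≤ 0 := by
  have h := (hasDerivWithinAt_iff_tendsto_slope' (s := Iio R) (by simp)).1 hφ.hasDerivWithinAt
  refine le_of_tendsto h ?_
  filter_upwards [Ioo_mem_nhdsLT hR] with s hs
  rw [slope_def_field, hφR, sub_zero]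
  exact div_nonpos_of_nonneg_of_nonpos (hpos s hs.1.le hs.2).le (sub_nonpos.2 hs.2.le)

lemma eventually_forall_Icc_pos {φ : ℝ → ℝ} (hφ : Continuous φ) {R : ℝ}
    (hpos : ∀ s ∈ Icc 0 R, 0 < φ s) (hR : 0 < φ R) :
    ∀ᶠ r in 𝓝[>] R, ∀ s ∈ Icc 0 r, 0 < φ s := by
  obtain ⟨ε, hε, hball⟩ := Metric.eventually_nhds_iff.1 (hφ.continuousAt.eventually_const_lt hR)
  filter_upwards [Ioo_mem_nhdsGT (lt_add_of_pos_right R hε)] with r hr s hs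
  rcases le_or_gt s R with h | h
  · exact hpos s ⟨hs.1, h⟩
  · refine hball ?_
    rw [Real.dist_eq, abs_lt]
    constructor <;> linarith [hs.2, hr.2]

end FirstZero

section TruncatedPower

/-- The power `x ↦ x ^ p` with its argument truncated to `[0, 1]`. -/
def cpow (p x : ℝ) : ℝ := (projIcc (0 : ℝ) 1 zero_le_one x : ℝ) ^ p

lemma cpow_nonneg (p x : ℝ) : 0 ≤ cpow p x := Real.rpow_nonneg (projIcc 0 1 _ x).2.1 p

lemma cpow_le_one {p : ℝ} (hp : 0 ≤ p) (x : ℝ) : cpow p x ≤ 1 :=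
  Real.rpow_le_one (projIcc 0 1 _ x).2.1 (projIcc 0 1 _ x).2.2 hp

lemma cpow_eq {p x : ℝ} (h0 : 0 ≤ x) (h1 : x ≤ 1) : cpow p x = x ^ p := by
  rw [cpow, projIcc_of_mem zero_le_one ⟨h0, h1⟩]

lemma exists_lipschitzWith_cpow {p : ℝ} (hp : 1 ≤ p) : ∃ K, LipschitzWith K (cpow p) := by
  have h : LipschitzOnWith p.toNNReal (fun x : ℝ => x ^ p) (Icc 0 1) := by
    refine (convex_Icc 0 1).lipschitzOnWith_of_nnnorm_hasDerivWithin_le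
      (fun x _ => (Real.hasDerivAt_rpow_const (Or.inr hp)).hasDerivWithinAt) fun x hx => ?_
    rw [← NNReal.coe_le_coe, coe_nnnorm, Real.coe_toNNReal p (by linarith), Real.norm_of_nonneg
      (mul_nonneg (by linarith) (Real.rpow_nonneg hx.1 _))]
    exact mul_le_of_le_one_right (by linarith) (Real.rpow_le_one hx.1 hx.2 (by linarith))
  refine ⟨p.toNNReal, LipschitzWith.of_dist_le_mul fun x y =>
    (h.dist_le_mul _ (projIcc 0 1 _ x).2 _ (projIcc 0 1 _ y).2).trans ?_⟩
  gcongr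
  simpa [Subtype.dist_eq] using (LipschitzWith.projIcc (zero_le_one' ℝ)).dist_le_mul x y

lemma continuous_cpow {p : ℝ} (hp : 1 ≤ p) : Continuous (cpow p) :=
  (exists_lipschitzWith_cpow hp).choose_spec.continuous

end TruncatedPower

/-- Radial solutions, in dimension `N + 1`, of the system with truncated powers, whose initial
values lie on the segment from `(0, 1)` to `(1, 0)`. -/
structure IsRadialSolution (N : ℕ) (p q : ℝ) (u v : ℝ → ℝ) : Prop where
  cont_u : Continuous u
  cont_v : Continuous v
  deriv_u : ∀ r, 0 ≤ r → HasDerivAt u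
    (-(r * radialAvg N (fun s => cpow p (v s) + cpow q (v s) - cpow p (u s)) r)) r
  deriv_v : ∀ r, 0 ≤ r → HasDerivAt v (-(r * radialAvg N (fun s => cpow p (u s)) r)) r
  u_zero : 0 ≤ u 0
  v_zero : 0 ≤ v 0
  sum_zero : u 0 + v 0 = 1

namespace IsRadialSolution

variable {N : ℕ} {p q : ℝ} {u v : ℝ → ℝ}

lemma antitoneOn_v (h : IsRadialSolution N p q u v) : AntitoneOn v (Ici 0) := by
  refine antitoneOn_of_deriv_nonpos (convex_Ici 0) h.cont_v.continuousOn
    (fun r hr => ?_) fun r hr => ?_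
  · exact (h.deriv_v r (interior_subset hr)).differentiableAt.differentiableWithinAt
  · rw [(h.deriv_v r (interior_subset hr)).deriv, neg_nonpos]
    exact mul_nonneg (interior_subset hr) (radialAvg_nonneg N (fun _ => cpow_nonneg _ _) r)

lemma continuous_source_u (h : IsRadialSolution N p q u v) (hp : 1 ≤ p) (hq : 1 ≤ q) :
    Continuous fun s => cpow p (v s) + cpow q (v s) - cpow p (u s) :=
  (((continuous_cpow hp).comp h.cont_v).add ((continuous_cpow hq).comp h.cont_v)).sub
    ((continuous_cpow hp).comp h.cont_u)

lemma continuous_source_v (h : IsRadialSolution N p q u v) (hp : 1 ≤ p) :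
    Continuous fun s => cpow p (u s) :=
  (continuous_cpow hp).comp h.cont_u

lemma antitoneOn_add (h : IsRadialSolution N p q u v) (hp : 1 ≤ p) (hq : 1 ≤ q) :
    AntitoneOn (fun r => u r + v r) (Ici 0) := by
  have hd : ∀ r, 0 ≤ r → HasDerivAt (fun r => u r + v r)
      (-(r * radialAvg N (fun s => cpow p (v s) + cpow q (v s)) r)) r := fun r hr => by
    refine ((h.deriv_u r hr).add (h.deriv_v r hr)).congr_deriv ?_
    have hc : Continuous fun s => cpow p (v s) + cpow q (v s) :=
      ((continuous_cpow hp).comp h.cont_v).add ((continuous_cpow hq).comp h.cont_v)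
    rw [radialAvg_sub N hc (h.continuous_source_v hp) r]
    ring
  refine antitoneOn_of_deriv_nonpos (convex_Ici 0) (h.cont_u.add h.cont_v).continuousOn
    (fun r hr => ?_) fun r hr => ?_
  · exact (hd r (interior_subset hr)).differentiableAt.differentiableWithinAt
  · rw [(hd r (interior_subset hr)).deriv, neg_nonpos]
    exact mul_nonneg (interior_subset hr)
      (radialAvg_nonneg N (fun _ => add_nonneg (cpow_nonneg _ _) (cpow_nonneg _ _)) r)

lemma add_le_one (h : IsRadialSolution N p q u v) (hp : 1 ≤ p) (hq : 1 ≤ q) {r : ℝ}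
    (hr : 0 ≤ r) : u r + v r ≤ 1 :=
  (h.antitoneOn_add hp hq self_mem_Ici hr hr).trans h.sum_zero.le

/-- Pohozaev's identity: the two components cannot vanish simultaneously at a first zero. -/
lemma not_both_zero (h : IsRadialSolution N p q u v) (hp : 1 ≤ p) (hq : 1 ≤ q)
    (hp' : ((N : ℝ) + 1) / (p + 1) ≤ (N - 1) / 2) (hq' : ((N : ℝ) + 1) / (q + 1) ≤ (N - 1) / 2)
    {R : ℝ} (hR : 0 < R) (hu : ∀ s, 0 ≤ s → s < R → 0 < u s)
    (hv : ∀ s, 0 ≤ s → s < R → 0 < v s) (huR : u R = 0) (hvR : v R = 0) : False := by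
  set a := radialAvg N (fun s => cpow p (v s) + cpow q (v s) - cpow p (u s)) with ha_def
  set b := radialAvg N (fun s => cpow p (u s)) with hb_def
  have hp0 : p + 1 ≠ 0 := by positivity
  have hq0 : q + 1 ≠ 0 := by positivity
  have hca : Continuous a := continuous_radialAvg N (h.continuous_source_u hp hq)
  have hcb : Continuous b := continuous_radialAvg N (h.continuous_source_v hp)
  have hcu := h.cont_u
  have hcv := h.cont_v
  set P : ℝ → ℝ := fun r =>
    r ^ (N + 1) * (r ^ 2 * (a r * b r + b r ^ 2 / 2) +
      (u r ^ (p + 1) / (p + 1) + v r ^ (p + 1) / (p + 1) + v r ^ (q + 1) / (q + 1))) -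
    ((N : ℝ) - 1) / 2 * (r ^ (N + 1) * (u r * b r + v r * a r + v r * b r)) with hP
  have hcP : Continuous P := by
    have h1 : Continuous fun r => u r ^ (p + 1) := hcu.rpow_const fun _ => Or.inr (by linarith)
    have h2 : Continuous fun r => v r ^ (p + 1) := hcv.rpow_const fun _ => Or.inr (by linarith)
    have h3 : Continuous fun r => v r ^ (q + 1) := hcv.rpow_const fun _ => Or.inr (by linarith)
    fun_prop
  have hdP : ∀ r ∈ Ioo 0 R, HasDerivAt P (r ^ N * (
      (((N : ℝ) + 1) / (p + 1) - (N - 1) / 2) * (u r ^ p * u r + v r ^ p * v r) +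
      (((N : ℝ) + 1) / (q + 1) - (N - 1) / 2) * (v r ^ q * v r))) r := by
    intro r hr
    have hr0 := hr.1.ne'
    have hur := hu r hr.1.le hr.2
    have hvr := hv r hr.1.le hr.2
    have hsum := h.add_le_one hp hq hr.1.le
    have du := h.deriv_u r hr.1.le
    have dv := h.deriv_v r hr.1.le
    have da := hasDerivAt_radialAvg N (h.continuous_source_u hp hq) hr0
    have db := hasDerivAt_radialAvg N (h.continuous_source_v hp) hr0
    rw [← ha_def] at du da
    rw [← hb_def] at dv db
    simp only [smul_eq_mul] at da db
    rw [cpow_eq hvr.le (by linarith), cpow_eq hvr.le (by linarith),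
      cpow_eq hur.le (by linarith)] at da
    rw [cpow_eq hur.le (by linarith)] at db
    have d1 := du.rpow_const (p := p + 1) (Or.inl hur.ne')
    have d2 := dv.rpow_const (p := p + 1) (Or.inl hvr.ne')
    have d3 := dv.rpow_const (p := q + 1) (Or.inl hvr.ne')
    rw [add_sub_cancel_right] at d1 d2 d3
    have dr := hasDerivAt_pow (N + 1) r
    have D := (dr.mul (((hasDerivAt_pow 2 r).mul ((da.mul db).add ((db.pow 2).div_const 2))).add
      (((d1.div_const (p + 1)).add (d2.div_const (p + 1))).add (d3.div_const (q + 1))))).sub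
      ((dr.mul (((du.mul db).add (dv.mul da)).add (dv.mul db))).const_mul (((N : ℝ) - 1) / 2))
    refine D.congr_deriv ?_
    simp only [Pi.mul_apply, Pi.add_apply, Pi.pow_apply, Nat.add_sub_cancel]
    rw [Real.rpow_add_one hur.ne', Real.rpow_add_one hvr.ne', Real.rpow_add_one hvr.ne']
    push_cast
    field_simp
    ring
  have hanti : AntitoneOn P (Icc 0 R) := by
    refine antitoneOn_of_deriv_nonpos (convex_Icc 0 R) hcP.continuousOn
      (fun r hr => ?_) fun r hr => ?_
    · rw [interior_Icc] at hr
      exact (hdP r hr).differentiableAt.differentiableWithinAt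
    · rw [interior_Icc] at hr
      rw [(hdP r hr).deriv]
      have hur := hu r hr.1.le hr.2
      have hvr := hv r hr.1.le hr.2
      refine mul_nonpos_of_nonneg_of_nonpos (pow_nonneg hr.1.le N) (add_nonpos ?_ ?_)
      · exact mul_nonpos_of_nonpos_of_nonneg (by linarith) (by positivity)
      · exact mul_nonpos_of_nonpos_of_nonneg (by linarith) (by positivity)
  have hPR : P R ≤ P 0 := hanti (left_mem_Icc.2 hR.le) (right_mem_Icc.2 hR.le) hR.le
  have haR : 0 ≤ a R := by
    have := deriv_nonpos_of_pos_left hR (h.deriv_u R hR.le) huR hu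
    rw [neg_nonpos] at this
    exact nonneg_of_mul_nonneg_right this hR
  have hbR : 0 < b R := radialAvg_pos N (h.continuous_source_v hp) hR fun s h0 h1 => by
    have hus := hu s h0.le h1
    rw [cpow_eq hus.le (by linarith [h.add_le_one hp hq h0.le, hv s h0.le h1])]
    positivity
  have h0 : P 0 = 0 := by simp [hP]
  have h1 : P R = R ^ (N + 1) * (R ^ 2 * (a R * b R + b R ^ 2 / 2)) := by
    simp [hP, huR, hvR, Real.zero_rpow hp0, Real.zero_rpow hq0]
  have h2 : 0 < P R := by
    rw [h1]
    positivity
  linarith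

/-- Either `u` or `v` becomes negative before the other one, or both stay positive. -/
theorem trichotomy (h : IsRadialSolution N p q u v) (hp : 1 ≤ p) (hq : 1 ≤ q)
    (hp' : ((N : ℝ) + 1) / (p + 1) ≤ (N - 1) / 2)
    (hq' : ((N : ℝ) + 1) / (q + 1) ≤ (N - 1) / 2) :
    (∃ r, 0 ≤ r ∧ u r < 0 ∧ 0 < v r) ∨
    (∃ r, 0 ≤ r ∧ v r < 0 ∧ ∀ s ∈ Icc 0 r, 0 < u s) ∨
    ∀ r, 0 ≤ r → 0 < u r ∧ 0 < v r := by
  by_cases hall : ∀ r, 0 ≤ r → 0 < u r ∧ 0 < v r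
  · exact Or.inr (Or.inr hall)
  have hcu := h.cont_u
  have hcv := h.cont_v
  set Z : Set ℝ := {r | 0 ≤ r ∧ (u r ≤ 0 ∨ v r ≤ 0)} with hZ
  have hZc : IsClosed Z := (isClosed_le continuous_const continuous_id).inter
    ((isClosed_le hcu continuous_const).union (isClosed_le hcv continuous_const))
  have hZn : Z.Nonempty := by
    push Not at hall
    obtain ⟨r, hr, hr'⟩ := hall
    refine ⟨r, hr, ?_⟩
    by_contra! hcon
    exact absurd (hr' hcon.1) (not_le.2 hcon.2)
  have hZb : BddBelow Z := ⟨0, fun r hr => hr.1⟩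
  set R := sInf Z
  have hRZ : R ∈ Z := hZc.csInf_mem hZn hZb
  have hR : 0 ≤ R := hRZ.1
  have hbefore : ∀ s, 0 ≤ s → s < R → 0 < u s ∧ 0 < v s := by
    intro s hs hsR
    by_contra! hcon
    refine absurd (csInf_le hZb (a := s) ⟨hs, ?_⟩) (not_le.2 hsR)
    rcases le_or_gt (u s) 0 with h1 | h1
    · exact Or.inl h1
    · exact Or.inr (hcon h1)
  have hnonneg : ∀ φ : ℝ → ℝ, Continuous φ → 0 ≤ φ 0 → (∀ s, 0 ≤ s → s < R → 0 < φ s) →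
      0 ≤ φ R := by
    intro φ hφ h0 hpos
    rcases hR.eq_or_lt with h1 | h1
    · rwa [← h1]
    · refine ge_of_tendsto (hφ.continuousAt.continuousWithinAt (s := Iio R)).tendsto ?_
      filter_upwards [Ioo_mem_nhdsLT h1] with s hs
      exact (hpos s hs.1.le hs.2).le
  have huR := hnonneg u hcu h.u_zero fun s h0 h1 => (hbefore s h0 h1).1
  have hvR := hnonneg v hcv h.v_zero fun s h0 h1 => (hbefore s h0 h1).2
  have hsum := h.add_le_one hp hq hR
  rcases huR.eq_or_lt with hu0 | hu0
  · rcases hvR.eq_or_lt with hv0 | hv0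
    · exfalso
      rcases hR.eq_or_lt with h1 | h1
      · have := h.sum_zero
        rw [h1] at this
        linarith
      · exact h.not_both_zero hp hq hp' hq' h1 (fun s h2 h3 => (hbefore s h2 h3).1)
          (fun s h2 h3 => (hbefore s h2 h3).2) hu0.symm hv0.symm
    · left
      have hsrc : 0 < cpow p (v R) + cpow q (v R) - cpow p (u R) := by
        rw [← hu0, cpow_eq le_rfl zero_le_one, Real.zero_rpow (zero_lt_one.trans_le hp).ne',
          cpow_eq hvR (by linarith), cpow_eq hvR (by linarith), sub_zero]
        positivity
      have havg : 0 ≤ radialAvg N (fun s => cpow p (v s) + cpow q (v s) - cpow p (u s)) R := by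
        rcases hR.eq_or_lt with h1 | h1
        · rw [← h1] at hsrc ⊢
          rw [← radialAvg_zero N fun s => cpow p (v s) + cpow q (v s) - cpow p (u s)] at hsrc
          exact (pos_of_mul_pos_right hsrc (by positivity)).le
        · have := deriv_nonpos_of_pos_left h1 (h.deriv_u R hR) hu0.symm
            fun s h2 h3 => (hbefore s h2 h3).1
          rw [neg_nonpos] at this
          exact nonneg_of_mul_nonneg_right this h1
      have h1 := eventually_neg_of_zero N (h.continuous_source_u hp hq) h.deriv_u hR hu0.symm
        havg hsrc
      have h2 : ∀ᶠ r in 𝓝[>] R, 0 < v r :=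
        (hcv.continuousAt.eventually_const_lt hv0).filter_mono nhdsWithin_le_nhds
      obtain ⟨r, hr1, hr2, hr3⟩ := (h1.and (h2.and self_mem_nhdsWithin)).exists
      exact ⟨r, hR.trans (le_of_lt hr3), hr1, hr2⟩
  · right; left
    have hv0 : v R = 0 := by
      rcases hRZ.2 with h1 | h1
      · exact absurd h1 (not_le.2 hu0)
      · exact le_antisymm h1 hvR
    have hsrc : 0 < cpow p (u R) := by
      rw [cpow_eq huR (by linarith)]
      positivity
    have h1 := eventually_neg_of_zero N (h.continuous_source_v hp) h.deriv_v hR hv0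
      (radialAvg_nonneg N (fun _ => cpow_nonneg _ _) R) hsrc
    have h2 := eventually_forall_Icc_pos hcu (R := R) (fun s hs => by
      rcases hs.2.eq_or_lt with h3 | h3
      · rwa [h3]
      · exact (hbefore s hs.1 h3).1) hu0
    obtain ⟨r, hr1, hr2, hr3⟩ := (h1.and (h2.and self_mem_nhdsWithin)).exists
    exact ⟨r, hR.trans (le_of_lt hr3), hr1, hr2⟩

end IsRadialSolution

/-- The family of truncated radial solutions starting on the segment from `(0, 1)` to `(1, 0)`. -/
theorem exists_radial_family (N : ℕ) {p q : ℝ} (hp : 1 ≤ p) (hq : 1 ≤ q) :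
    ∃ u v : ℝ → ℝ → ℝ, (∀ t ∈ Icc (0 : ℝ) 1, IsRadialSolution N p q (u t) (v t)) ∧
      (∀ t, Continuous (u t)) ∧ (∀ t, u t 0 = t) ∧ (∀ t, v t 0 = 1 - t) ∧
      ∃ lam : ℝ, 0 ≤ lam ∧ ∀ t t' r, 0 ≤ r →
        dist (u t r) (u t' r) ≤ 2 * dist t t' * Real.exp (lam * r ^ 2) ∧
        dist (v t r) (v t' r) ≤ 2 * dist t t' * Real.exp (lam * r ^ 2) := by
  obtain ⟨K₁, hK₁⟩ := exists_lipschitzWith_cpow hp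
  obtain ⟨K₂, hK₂⟩ := exists_lipschitzWith_cpow hq
  set F : ℝ × ℝ → ℝ × ℝ := fun x => (cpow p x.2 + cpow q x.2 - cpow p x.1, cpow p x.1) with hF
  have hFlip : LipschitzWith _ F :=
    (((hK₁.comp LipschitzWith.prod_snd).add (hK₂.comp LipschitzWith.prod_snd)).sub
      (hK₁.comp LipschitzWith.prod_fst)).prodMk (hK₁.comp LipschitzWith.prod_fst)
  have hFbd : ∀ x, ‖F x‖ ≤ 2 := fun x => by
    have h1 := cpow_nonneg p x.1
    have h2 := cpow_nonneg p x.2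
    have h3 := cpow_nonneg q x.2
    have h4 := cpow_le_one (zero_le_one.trans hp) x.1
    have h5 := cpow_le_one (zero_le_one.trans hp) x.2
    have h6 := cpow_le_one (zero_le_one.trans hq) x.2
    refine max_le ?_ ?_ <;> rw [Real.norm_eq_abs, abs_le] <;> constructor <;> simp only [hF] <;>
      linarith
  obtain ⟨w, hwc, hw0, hwd, lam, hlam, hdist⟩ := exists_radial_solution_s12 N hFlip hFbd
  have hdt : ∀ t t' : ℝ, dist (t, 1 - t) (t', 1 - t') = dist t t' := fun t t' => by
    simp only [Prod.dist_eq, dist_sub_left, max_self]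
  refine ⟨fun t r => (w (t, 1 - t) r).1, fun t r => (w (t, 1 - t) r).2, fun t ht => ?_,
    fun t => (hwc _).fst, fun t => by simp only [hw0], fun t => by simp only [hw0], lam, hlam, fun t t' r hr => ?_⟩
  · have hFw : Continuous fun s => F (w (t, 1 - t) s) := hFlip.continuous.comp (hwc _)
    refine ⟨(hwc _).fst, (hwc _).snd, fun r hr => ?_, fun r hr => ?_, ?_, ?_, ?_⟩
    · have h1 := (ContinuousLinearMap.fst ℝ ℝ ℝ).hasFDerivAt.comp_hasDerivAt r
        (hwd (t, 1 - t) r hr)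
      rw [map_neg, map_smul, radialAvg_clm N _ hFw] at h1
      exact h1
    · have h1 := (ContinuousLinearMap.snd ℝ ℝ ℝ).hasFDerivAt.comp_hasDerivAt r
        (hwd (t, 1 - t) r hr)
      rw [map_neg, map_smul, radialAvg_clm N _ hFw] at h1
      exact h1
    · simpa only [hw0] using ht.1
    · simpa only [hw0] using sub_nonneg.2 ht.2
    · simp [hw0]
  · have h1 := hdist (t, 1 - t) (t', 1 - t') r hr
    rw [hdt] at h1
    exact ⟨(le_max_left _ _).trans h1, (le_max_right _ _).trans h1⟩

/-- Shooting along the segment of initial values produces a positive global radial solution. -/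
theorem exists_positive_radial_solution (N : ℕ) {p q : ℝ} (hp : 1 ≤ p) (hq : 1 ≤ q)
    (hp' : ((N : ℝ) + 1) / (p + 1) ≤ (N - 1) / 2)
    (hq' : ((N : ℝ) + 1) / (q + 1) ≤ (N - 1) / 2) :
    ∃ u v : ℝ → ℝ, IsRadialSolution N p q u v ∧ ∀ r, 0 ≤ r → 0 < u r ∧ 0 < v r := by
  obtain ⟨u, v, hsol, hu, hu0, hv0, lam, hlam, hdist⟩ := exists_radial_family N hp hq
  have hcont : ∀ f : ℝ → ℝ → ℝ, (∀ t t' r, 0 ≤ r →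
      dist (f t r) (f t' r) ≤ 2 * dist t t' * Real.exp (lam * r ^ 2)) →
      ∀ r, 0 ≤ r → Continuous fun t => f t r := fun f hf r hr => by
    refine (LipschitzWith.of_dist_le_mul (K := (2 * Real.exp (lam * r ^ 2)).toNNReal)
      fun t t' => (hf t t' r hr).trans (le_of_eq ?_)).continuous
    rw [Real.coe_toNNReal _ (by positivity)]
    ring
  have hcu := hcont u fun t t' r hr => (hdist t t' r hr).1
  have hcv := hcont v fun t t' r hr => (hdist t t' r hr).2
  let A : Set ℝ := {t | ∃ r, 0 ≤ r ∧ u t r < 0 ∧ 0 < v t r}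
  let B : Set ℝ := {t | ∃ r, 0 ≤ r ∧ v t r < 0 ∧ ∀ s ∈ Icc 0 r, 0 < u t s}
  have hAo : IsOpen A := by
    rw [isOpen_iff_mem_nhds]
    rintro t ⟨r, hr, h1, h2⟩
    filter_upwards [(hcu r hr).continuousAt.eventually_lt_const h1,
      (hcv r hr).continuousAt.eventually_const_lt h2] with t' h3 h4
    exact ⟨r, hr, h3, h4⟩
  have hBo : IsOpen B := by
    rw [isOpen_iff_mem_nhds]
    rintro t ⟨r, hr, h1, h2⟩
    obtain ⟨m, hm, hmin⟩ := isCompact_Icc.exists_isMinOn (nonempty_Icc.2 hr) (hu t).continuousOn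
    have hc : Continuous fun t' => 2 * dist t t' * Real.exp (lam * r ^ 2) := by fun_prop
    filter_upwards [(hcv r hr).continuousAt.eventually_lt_const h1,
      hc.continuousAt.eventually_lt_const (u := u t m) (by simpa using h2 m hm)] with t' h3 h4
    refine ⟨r, hr, h3, fun s hs => ?_⟩
    have h5 : Real.exp (lam * s ^ 2) ≤ Real.exp (lam * r ^ 2) :=
      Real.exp_le_exp.2 (mul_le_mul_of_nonneg_left (pow_le_pow_left₀ hs.1 hs.2 2) hlam)
    have h6 := (hdist t t' s hs.1).1.trans
      (mul_le_mul_of_nonneg_left h5 (mul_nonneg zero_le_two dist_nonneg))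
    rw [Real.dist_eq] at h6
    have h7 : u t m ≤ u t s := hmin hs
    linarith [le_abs_self (u t s - u t' s)]
  have h0 : (0 : ℝ) ∈ Icc (0 : ℝ) 1 := left_mem_Icc.2 zero_le_one
  have h1 : (1 : ℝ) ∈ Icc (0 : ℝ) 1 := right_mem_Icc.2 zero_le_one
  have h0A : (0 : ℝ) ∈ A := by
    rcases (hsol 0 h0).trichotomy hp hq hp' hq' with h | ⟨r, hr, -, h⟩ | h
    · exact h
    · exact absurd (hu0 0) (h 0 (left_mem_Icc.2 hr)).ne'
    · exact absurd (hu0 0) (h 0 le_rfl).1.ne'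
  have h1B : (1 : ℝ) ∈ B := by
    have hv1 : v 1 0 = 0 := by rw [hv0, sub_self]
    rcases (hsol 1 h1).trichotomy hp hq hp' hq' with ⟨r, hr, -, h⟩ | h | h
    · exact absurd (((hsol 1 h1).antitoneOn_v self_mem_Ici hr hr).trans hv1.le) (not_le.2 h)
    · exact h
    · exact absurd hv1 (h 0 le_rfl).2.ne'
  by_cases hcover : Icc (0 : ℝ) 1 ⊆ A ∪ B
  · obtain ⟨t, ht, ⟨r, hr, hur, hvr⟩, r', hr', hvr', hur'⟩ :=
      isPreconnected_Icc A B hAo hBo hcover ⟨0, h0, h0A⟩ ⟨1, h1, h1B⟩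
    rcases le_or_gt r r' with h | h
    · exact absurd (hur' r ⟨hr, h⟩) hur.not_gt
    · exact absurd ((hsol t ht).antitoneOn_v hr' hr h.le) (not_le.2 (hvr'.trans hvr))
  · obtain ⟨t, ht, hAB⟩ := not_subset.1 hcover
    refine ⟨u t, v t, hsol t ht, ?_⟩
    rcases (hsol t ht).trichotomy hp hq hp' hq' with h | h | h
    · exact absurd (Or.inl h) hAB
    · exact absurd (Or.inr h) hAB
    · exact h

lemma exponent_bounds {N : ℕ} (hN : 2 ≤ N) {p : ℝ}
    (hp : (((N + 1 : ℕ) : ℝ) + 2) / (((N + 1 : ℕ) : ℝ) - 2) ≤ p) :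
    1 ≤ p ∧ ((N : ℝ) + 1) / (p + 1) ≤ (N - 1) / 2 := by
  have hN' : (2 : ℝ) ≤ N := by exact_mod_cast hN
  push_cast at hp
  rw [div_le_iff₀ (by linarith)] at hp
  have hp1 : 1 ≤ p := by
    by_contra! h
    nlinarith
  refine ⟨hp1, ?_⟩
  rw [div_le_div_iff₀ (by linarith) two_pos]
  linarith

/-- **Existence for the system** `-Δu = v^p + v^q - u^p`, `-Δv = u^p` in `ℝ^n`:
for `p ≠ q` with `p, q ≥ (n+2)/(n-2)` it admits a positive radially symmetric C²
solution. -/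
theorem example2_existence (n : ℕ) (hn : 3 ≤ n) (p q : ℝ) (hpq : p ≠ q)
    (hp : ((n:ℝ) + 2) / ((n:ℝ) - 2) ≤ p) (hq : ((n:ℝ) + 2) / ((n:ℝ) - 2) ≤ q) :
    ∃ u v : EuclideanSpace ℝ (Fin n) → ℝ,
      ContDiff ℝ 2 u ∧ ContDiff ℝ 2 v ∧
      (∀ x, 0 < u x) ∧ (∀ x, 0 < v x) ∧
      (∀ x y : EuclideanSpace ℝ (Fin n), ‖x‖ = ‖y‖ → u x = u y) ∧
      (∀ x y : EuclideanSpace ℝ (Fin n), ‖x‖ = ‖y‖ → v x = v y) ∧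
      (∀ x, - lap u x = v x ^ p + v x ^ q - u x ^ p) ∧
      (∀ x, - lap v x = u x ^ p) := by
  obtain ⟨N, rfl⟩ : ∃ N, n = N + 1 := ⟨n - 1, by omega⟩
  obtain ⟨hp1, hp'⟩ := exponent_bounds (by omega) hp
  obtain ⟨hq1, hq'⟩ := exponent_bounds (by omega) hq
  obtain ⟨u, v, h, hpos⟩ := exists_positive_radial_solution N hp1 hq1 hp' hq'
  have hpow : ∀ r, 0 ≤ r → cpow p (u r) = u r ^ p ∧ cpow p (v r) = v r ^ p ∧
      cpow q (v r) = v r ^ q := fun r hr => by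
    obtain ⟨h1, h2⟩ := hpos r hr
    have h3 := h.add_le_one hp1 hq1 hr
    exact ⟨cpow_eq h1.le (by linarith), cpow_eq h2.le (by linarith),
      cpow_eq h2.le (by linarith)⟩
  have hgu := h.continuous_source_u hp1 hq1
  have hgv := h.continuous_source_v hp1
  refine ⟨fun x => u ‖x‖, fun x => v ‖x‖, contDiff_two_radial N hgu h.deriv_u,
    contDiff_two_radial N hgv h.deriv_v, fun x => (hpos _ (norm_nonneg x)).1,
    fun x => (hpos _ (norm_nonneg x)).2, fun x y hxy => congrArg u hxy,
    fun x y hxy => congrArg v hxy, fun x => ?_, fun x => ?_⟩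
  · obtain ⟨h1, h2, h3⟩ := hpow _ (norm_nonneg x)
    rw [neg_lap_radial N hgu h.deriv_u, h1, h2, h3]
  · rw [neg_lap_radial N hgv h.deriv_v, (hpow _ (norm_nonneg x)).1]
end
end
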